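/- arXiv:1306.5693 — 3 statements merged into one kernel-verified Lean document; each statement's English description precedes it below -/
import Mathlib

section
/- Let V be a finite-dimensional vector space over ℚ, W a finite increasing filtration on V, N : V → V nilpotent with N(W_w) ⊆ W_w for all w, and let W' be the relative monodromy filtration of N with respect to W. Suppose (U'_w)⁽¹⁾ and (U'_w)⁽²⁾ are two splittings of W', each satisfying N(U'_w) ⊆ U'_{w−2} for all w and each compatible with W. For i = 1,2 let (U_w)⁽ⁱ⁾ be the Deligne splitting of W associated to (U'_w)⁽ⁱ⁾, let N_w⁽ⁱ⁾ be the weight-w component of N in the grading of End(V) induced by (U_w)⁽ⁱ⁾, and let N̄_w⁽ⁱ⁾ be its class in gr^{W'}_{−2} gr^W_w End(V). Then for every w ≤ −2, N̄_w⁽¹⁾ = N̄_w⁽²⁾; that is, the element N̄_w of the primitive component of gr^{W'}_{−2} gr^W_w End(V) is independent of the choice of such a splitting of W'. -/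
open Submodule

section Defs

variable {V : Type*} [AddCommGroup V] [Module ℚ V]

/-- A finite increasing filtration on `V` indexed by `ℤ`: a monotone family of subspaces
which is `⊥` for all sufficiently small indices and `⊤` for all sufficiently large indices. -/
def IsFiniteFiltration (W : ℤ → Submodule ℚ V) : Prop :=
  Monotone W ∧ (∃ a : ℤ, ∀ w : ℤ, w ≤ a → W w = ⊥) ∧ (∃ b : ℤ, ∀ w : ℤ, b ≤ w → W w = ⊤)

/-- `grSub W W' w n = (W'_n ⊓ W_w) ⊔ W_{w-1}`, the submodule of `V` such that
`gr^{W'}_n gr^W_w = grSub W W' w n / grSub W W' w (n-1)`. -/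
def grSub (W W' : ℤ → Submodule ℚ V) (w n : ℤ) : Submodule ℚ V :=
  (W' n ⊓ W w) ⊔ W (w - 1)

/-- `W'` is the relative monodromy filtration of the nilpotent endomorphism `N` with respect to
the filtration `W`:  `W'` is a finite increasing filtration, `N W'_w ⊆ W'_{w-2}` for all `w`, and
for all `w` and `m ≥ 0` the map induced by `N^m` from `gr^{W'}_{w+m} gr^W_w` to
`gr^{W'}_{w-m} gr^W_w` is well defined and bijective (expressed on the level of submodules
of `V`). -/
def IsRelMonFil (N : Module.End ℚ V) (W W' : ℤ → Submodule ℚ V) : Prop :=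
  IsFiniteFiltration W' ∧
  (∀ w : ℤ, ∀ x ∈ W' w, N x ∈ W' (w - 2)) ∧
  ∀ (w : ℤ) (m : ℕ),
    (∀ x ∈ grSub W W' w (w + m), (N ^ m) x ∈ grSub W W' w (w - m)) ∧
    (∀ x ∈ grSub W W' w (w + m - 1), (N ^ m) x ∈ grSub W W' w (w - m - 1)) ∧
    (∀ x ∈ grSub W W' w (w + m), (N ^ m) x ∈ grSub W W' w (w - m - 1) →
      x ∈ grSub W W' w (w + m - 1)) ∧
    grSub W W' w (w - m) ≤
      Submodule.map (N ^ m : Module.End ℚ V) (grSub W W' w (w + m)) ⊔ grSub W W' w (w - m - 1)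

/-- The filtration induced on `End(V)` by a filtration `W` on `V`:
`W_k End(V) = {f | f(W_w) ⊆ W_{w+k} for all w}`. -/
def endFilt (W : ℤ → Submodule ℚ V) (k : ℤ) : Submodule ℚ (Module.End ℚ V) where
  carrier := {f | ∀ w : ℤ, ∀ x ∈ W w, f x ∈ W (w + k)}
  add_mem' := fun hf hg w x hx => by
    simpa using (W (w + k)).add_mem (hf w x hx) (hg w x hx)
  zero_mem' := fun w x _ => by simp
  smul_mem' := fun c f hf w x hx => by
    simpa using (W (w + k)).smul_mem c (hf w x hx)

/-- `Ad(N) : End(V) → End(V)`, `f ↦ N ∘ f - f ∘ N`, as an endomorphism of `End(V)`. -/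
def adE (N : Module.End ℚ V) : Module.End ℚ (Module.End ℚ V) :=
  LinearMap.mulLeft ℚ N - LinearMap.mulRight ℚ N

/-- `U` is a splitting of the filtration `W`: `V = ⊕_w U_w` and `W_w = Σ_{n ≤ w} U_n`. -/
def IsSplitting (W U : ℤ → Submodule ℚ V) : Prop :=
  DirectSum.IsInternal U ∧ ∀ w : ℤ, W w = ⨆ n ≤ w, U n

/-- `c` is the weight decomposition of `f` with respect to the grading `U` of `V`:
`f = Σ_w c_w` (a finite sum) and `c_w (U_m) ⊆ U_{m+w}` for all `m`. -/
def IsWeightDecomp (U : ℤ → Submodule ℚ V) (f : Module.End ℚ V)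
    (c : ℤ → Module.End ℚ V) : Prop :=
  (Function.support c).Finite ∧ (∑ᶠ w : ℤ, c w) = f ∧
  ∀ w m : ℤ, ∀ x ∈ U m, (c w) x ∈ U (m + w)

/-- `U` is the Deligne splitting of `W` associated to the splitting `U'` of `W'`:
a splitting of `W` such that `V = ⊕_{m,n} (U_m ∩ U'_n)` and, for any weight decomposition
`c` of `N` with respect to `U`, the class `N̄_{-1}` of `c_{-1}` in
`gr^{W'}_{-2} gr^W_{-1} End(V)` vanishes and, for `w ≤ -2`, the class `N̄_w` of `c_w`
in `gr^{W'}_{-2} gr^W_w End(V)` lies in the primitive component, i.e. is killed by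
the map induced by `Ad(N)^{-w-1}` to `gr^{W'}_{2w} gr^W_w End(V)`. -/
def IsDeligneSplitting (N : Module.End ℚ V) (W W' U' U : ℤ → Submodule ℚ V) : Prop :=
  IsSplitting W U ∧
  DirectSum.IsInternal (fun p : ℤ × ℤ => U p.1 ⊓ U' p.2) ∧
  ∀ c : ℤ → Module.End ℚ V, IsWeightDecomp U N c →
    c (-1) ∈ grSub (endFilt W) (endFilt W') (-1) (-3) ∧
    ∀ w : ℤ, w ≤ -2 →
      c w ∈ grSub (endFilt W) (endFilt W') w (-2) ∧
      ((adE N) ^ (-w - 1).toNat) (c w) ∈ grSub (endFilt W) (endFilt W') w (2 * w - 1)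

end Defs


section Lefschetz

variable {V : Type*} [AddCommGroup V] [Module ℚ V]

lemma adE_apply (N f : Module.End ℚ V) : adE N f = N * f - f * N := rfl

/-- A polynomial function of degree less than `j` with values in a vector space vanishes
as soon as it has `j` zeros. -/
lemma sum_choose_smul_eq_zero (j : ℕ) (y : ℕ → V) (Z : Finset ℕ) (hZ : j ≤ Z.card)
    (h0 : ∀ a ∈ Z, ∑ i ∈ Finset.range j, (a.choose i : ℚ) • y i = 0) (a : ℕ) :
    ∑ i ∈ Finset.range j, (a.choose i : ℚ) • y i = 0 := by
  rw [← Module.forall_dual_apply_eq_zero_iff ℚ]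
  intro l
  rcases Nat.eq_zero_or_pos j with rfl | hj
  · simp
  let p : Polynomial ℚ := ∑ i ∈ Finset.range j,
    Polynomial.C (l (y i) * (i.factorial : ℚ)⁻¹) * descPochhammer ℚ i
  have hp : ∀ b : ℕ, p.eval (b : ℚ) = l (∑ i ∈ Finset.range j, (b.choose i : ℚ) • y i) := by
    intro b
    simp only [p, Polynomial.eval_finsetSum, map_sum, Polynomial.eval_mul, Polynomial.eval_C,
      map_smul, smul_eq_mul]
    refine Finset.sum_congr rfl fun i _ => ?_
    rw [Nat.cast_choose_eq_descPochhammer_div, div_eq_mul_inv]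
    ring
  have hdeg : p.natDegree < j := by
    refine lt_of_le_of_lt (Polynomial.natDegree_sum_le_of_forall_le (n := j - 1) _ _ ?_) (by omega)
    intro i hi
    refine (Polynomial.natDegree_C_mul_le _ _).trans ?_
    rw [descPochhammer_natDegree]
    have := Finset.mem_range.1 hi
    omega
  have hp0 : p = 0 := by
    refine Polynomial.eq_zero_of_natDegree_lt_card_of_eval_eq_zero' p
      (Z.map ⟨((↑) : ℕ → ℚ), Nat.cast_injective⟩) ?_ ?_
    · intro i hi
      obtain ⟨b, hb, rfl⟩ := Finset.mem_map.1 hi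
      simp [hp, h0 b hb]
    · simpa using lt_of_lt_of_le hdeg hZ
  rw [← hp, hp0, Polynomial.eval_zero]

/-- Expansion of `f N^a` in terms of the iterated commutators of `N` with `f`. -/
lemma mul_pow_eq_sum_adE (N f : Module.End ℚ V) (a : ℕ) :
    f * N ^ a = ∑ i ∈ Finset.range (a + 1),
      (a.choose i : ℚ) • ((-1 : ℚ) ^ i • (N ^ (a - i) * ((adE N) ^ i) f)) := by
  have hc : Commute (LinearMap.mulLeft ℚ N) (-(adE N)) := by
    refine LinearMap.ext fun x => ?_
    simp [adE, mul_sub, mul_assoc]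
  have hR : LinearMap.mulRight ℚ N = -(adE N) + LinearMap.mulLeft ℚ N := by
    simp [adE]
  have h1 : f * N ^ a = ((LinearMap.mulRight ℚ N) ^ a) f := by
    rw [LinearMap.pow_mulRight]; rfl
  rw [h1, hR, hc.symm.add_pow]
  rw [LinearMap.sum_apply]
  refine Finset.sum_congr rfl fun i _ => ?_
  rw [(hc.symm.pow_pow i (a - i)).eq, LinearMap.pow_mulLeft]
  have h2 : ((-adE N) ^ i) f = (-1 : ℚ) ^ i • ((adE N ^ i) f) := by
    rw [← neg_one_smul ℚ (adE N), smul_pow, LinearMap.smul_apply]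
  rw [← (Nat.cast_commute (a.choose i) _).eq, ← nsmul_eq_mul, LinearMap.smul_apply,
    Module.End.mul_apply, h2, Nat.cast_smul_eq_nsmul, LinearMap.mulLeft_apply, mul_smul_comm]

/-- If `x` generates an `N`-string of length at most `m + 1` and the iterated commutators of `f`
with `N` vanish from the `j`-th on, then `f` kills the string, provided that
`N ^ (m + j - 2 s)` is injective at `f (N ^ s x)`. -/
lemma apply_pow_eq_zero_of_adE_pow_eq_zero (N f : Module.End ℚ V) (j m : ℕ)
    (had : (adE N ^ j) f = 0) (x : V) (hx : (N ^ (m + 1)) x = 0)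
    (hinj : ∀ s r : ℕ, r + 2 * s = m + j → (N ^ r) (f ((N ^ s) x)) = 0 → f ((N ^ s) x) = 0)
    (a : ℕ) : f ((N ^ a) x) = 0 := by
  have hx' : ∀ s, m < s → f ((N ^ s) x) = 0 := by
    intro s hs
    obtain ⟨t, rfl⟩ := Nat.exists_eq_add_of_lt hs
    rw [show m + t + 1 = t + (m + 1) by ring, pow_add, Module.End.mul_apply, hx, map_zero, map_zero]
  have had' : ∀ i, j ≤ i → (adE N ^ i) f = 0 := by
    intro i hi
    obtain ⟨t, rfl⟩ := Nat.exists_eq_add_of_le' hi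
    rw [pow_add, Module.End.mul_apply, had, map_zero]
  have hexp : ∀ b M : ℕ, b ≤ M → (N ^ (M - b)) (f ((N ^ b) x)) =
      ∑ i ∈ Finset.range j, (b.choose i : ℚ) •
        ((-1 : ℚ) ^ i • (N ^ (M - i)) (((adE N ^ i) f) x)) := by
    intro b M hbM
    have h1 : f ((N ^ b) x) = (f * N ^ b) x := rfl
    rw [h1, mul_pow_eq_sum_adE, LinearMap.sum_apply, map_sum]
    have h2 : ∀ i ∈ Finset.range (b + 1),
        (N ^ (M - b)) (((b.choose i : ℚ) • ((-1 : ℚ) ^ i • (N ^ (b - i) * (adE N ^ i) f))) x) =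
        (b.choose i : ℚ) • ((-1 : ℚ) ^ i • (N ^ (M - i)) (((adE N ^ i) f) x)) := by
      intro i hi
      have := Finset.mem_range.1 hi
      rw [show M - i = (M - b) + (b - i) by omega, pow_add]
      simp
    rw [Finset.sum_congr rfl h2]
    rcases le_total (b + 1) j with h | h
    · refine Finset.sum_subset (Finset.range_mono h) fun i _ hi => ?_
      rw [Nat.choose_eq_zero_of_lt (by simpa using hi)]
      simp
    · refine (Finset.sum_subset (Finset.range_mono h) fun i _ hi => ?_).symm
      rw [had' i (by simpa using hi)]
      simp
  have hsmall : ∀ s, s < j → f ((N ^ s) x) = 0 := by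
    intro s
    induction s using Nat.strong_induction_on with
    | _ s ih =>
      intro hs
      rcases lt_or_ge m s with hms | hms
      · exact hx' s hms
      obtain ⟨r, hr⟩ : ∃ r, r + 2 * s = m + j := ⟨m + j - 2 * s, by omega⟩
      refine hinj s r hr ?_
      obtain ⟨M, hM⟩ : ∃ M, M + s = m + j := ⟨m + j - s, by omega⟩
      have hrM : r = M - s := by omega
      rw [hrM, hexp s M (by omega)]
      refine sum_choose_smul_eq_zero j _ (Finset.range s ∪ Finset.Icc (m + 1) M) ?_ ?_ s
      · rw [Finset.card_union_of_disjoint]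
        · simp only [Finset.card_range, Nat.card_Icc]
          omega
        · rw [Finset.disjoint_left]
          intro b hb hb'
          have := Finset.mem_range.1 hb
          have := Finset.mem_Icc.1 hb'
          omega
      · intro b hb
        rcases Finset.mem_union.1 hb with hb | hb
        · have hb := Finset.mem_range.1 hb
          rw [← hexp b M (by omega), ih b hb (by omega), map_zero]
        · have hb := Finset.mem_Icc.1 hb
          rw [← hexp b M (by omega), hx' b (by omega), map_zero]
  rcases lt_or_ge a j with h | h
  · exact hsmall a h
  have h3 := hexp a a le_rfl
  rw [Nat.sub_self, pow_zero, Module.End.one_apply] at h3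
  rw [h3]
  refine sum_choose_smul_eq_zero j _ (Finset.range j) (by simp) ?_ a
  intro b hb
  have hb := Finset.mem_range.1 hb
  rw [← hexp b a (by omega), hsmall b hb, map_zero]

/-- Let `N` be nilpotent on a bigraded space `⊕ B w d`, of bidegree `(0, -2)`, such that
`N ^ m : B w m → B w (-m)` is bijective. Then `Ad(N) ^ j` is injective on endomorphisms of
bidegree `(-j, j)`. -/
lemma eq_zero_of_adE_pow_eq_zero (N f : Module.End ℚ V) (hN : IsNilpotent N)
    (B : ℤ → ℤ → Submodule ℚ V) (hB : ⨆ w, ⨆ d, B w d = ⊤)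
    (hNB : ∀ w d, ∀ x ∈ B w d, N x ∈ B w (d - 2))
    (hinj : ∀ w, ∀ m : ℕ, ∀ x ∈ B w m, (N ^ m) x = 0 → x = 0)
    (hsurj : ∀ w, ∀ m : ℕ, ∀ y ∈ B w (-m), ∃ x ∈ B w m, (N ^ m) x = y)
    (j : ℕ) (hf : ∀ w d, ∀ x ∈ B w d, f x ∈ B (w - j) (d + j))
    (had : (adE N ^ j) f = 0) : f = 0 := by
  obtain ⟨K, hK⟩ := hN
  have hNpow : ∀ (a : ℕ) w d, ∀ x ∈ B w d, (N ^ a) x ∈ B w (d - 2 * a) := by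
    intro a
    induction a with
    | zero => intro w d x hx; simpa using hx
    | succ a ih =>
      intro w d x hx
      rw [pow_succ', Module.End.mul_apply]
      have := hNB _ _ _ (ih w d x hx)
      convert this using 2
      push_cast
      ring
  have hprim : ∀ w (m : ℕ), ∀ x ∈ B w m, (N ^ (m + 1)) x = 0 → ∀ a, f ((N ^ a) x) = 0 := by
    intro w m x hx hx0
    refine apply_pow_eq_zero_of_adE_pow_eq_zero N f j m had x hx0 fun s r hr h => ?_
    refine hinj (w - j) r _ ?_ h
    have := hf _ _ _ (hNpow s w m x hx)
    convert this using 2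
    push_cast [← @Nat.cast_inj ℤ] at hr
    linarith
  have hpos : ∀ t m : ℕ, K ≤ m + t → ∀ w, ∀ x ∈ B w m, ∀ a, f ((N ^ a) x) = 0 := by
    intro t
    induction t with
    | zero =>
      intro m hm w x hx a
      have : x = 0 := by
        refine hinj w m x hx ?_
        rw [pow_eq_zero_of_le (by omega) hK, LinearMap.zero_apply]
      simp [this]
    | succ t ih =>
      intro m hm w x hx a
      have hx' := hNpow (m + 1) w m x hx
      rw [show (m : ℤ) - 2 * ((m + 1 : ℕ) : ℤ) = -((m + 2 : ℕ) : ℤ) by push_cast; ring] at hx'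
      obtain ⟨z, hz, hzx⟩ := hsurj w _ _ hx'
      have hp : (N ^ (m + 1)) (x - N z) = 0 := by
        rw [map_sub, ← hzx, ← Module.End.mul_apply, ← pow_succ, sub_self]
      have hNz : N z ∈ B w m := by
        have := hNB _ _ _ hz
        convert this using 2
        push_cast
        ring
      have h1 := hprim w m _ ((B w m).sub_mem hx hNz) hp a
      have h2 := ih (m + 2) (by omega) w z hz (a + 1)
      rw [pow_succ, Module.End.mul_apply] at h2
      rw [map_sub, map_sub, h2, sub_zero] at h1
      exact h1
  have hker : (⊤ : Submodule ℚ V) ≤ LinearMap.ker f := by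
    rw [← hB]
    refine iSup_le fun w => iSup_le fun d x hx => ?_
    rw [LinearMap.mem_ker]
    rcases le_total 0 d with hd | hd
    · lift d to ℕ using hd
      simpa using hpos K d (by omega) w x hx 0
    · obtain ⟨m, rfl⟩ : ∃ m : ℕ, d = -m := ⟨d.natAbs, by omega⟩
      obtain ⟨u, hu, rfl⟩ := hsurj w m x hx
      exact hpos K m (by omega) w u hu m
  exact LinearMap.ker_eq_top.1 (top_le_iff.1 hker)

end Lefschetz

section EndFilt

variable {V : Type*} [AddCommGroup V] [Module ℚ V]

lemma endFilt_mono {W : ℤ → Submodule ℚ V} (hW : Monotone W) : Monotone (endFilt W) :=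
  fun _ _ hab _ hf w x hx => hW (by omega) (hf w x hx)

lemma mul_mem_endFilt {W : ℤ → Submodule ℚ V} {a b c : ℤ} {f g : Module.End ℚ V}
    (hf : f ∈ endFilt W a) (hg : g ∈ endFilt W b) (hc : a + b = c) : f * g ∈ endFilt W c := by
  intro w x hx
  have := hf _ _ (hg w x hx)
  rwa [show w + b + a = w + c by omega] at this

lemma one_mem_endFilt (W : ℤ → Submodule ℚ V) : (1 : Module.End ℚ V) ∈ endFilt W 0 :=
  fun w x hx => by simpa using hx

lemma pow_mem_endFilt {W : ℤ → Submodule ℚ V} {a : ℤ} {f : Module.End ℚ V}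
    (hf : f ∈ endFilt W a) (n : ℕ) : f ^ n ∈ endFilt W (n * a) := by
  induction n with
  | zero => simpa using one_mem_endFilt W
  | succ n ih =>
    rw [pow_succ]
    exact mul_mem_endFilt ih hf (by push_cast; ring)

lemma pow_mem_endFilt_zero {W : ℤ → Submodule ℚ V} {f : Module.End ℚ V}
    (hf : f ∈ endFilt W 0) (n : ℕ) : f ^ n ∈ endFilt W 0 := by
  simpa using pow_mem_endFilt hf n

lemma pow_sub_pow_mem_endFilt {W : ℤ → Submodule ℚ V} {f g : Module.End ℚ V}
    (hf : f ∈ endFilt W 0) (hg : g ∈ endFilt W 0) (hfg : f - g ∈ endFilt W (-1)) (n : ℕ) :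
    f ^ n - g ^ n ∈ endFilt W (-1) := by
  induction n with
  | zero => simp
  | succ n ih =>
    rw [pow_succ, pow_succ, show f ^ n * f - g ^ n * g = (f ^ n - g ^ n) * f + g ^ n * (f - g) by
      noncomm_ring]
    exact add_mem (mul_mem_endFilt ih hf (by simp))
      (mul_mem_endFilt (pow_mem_endFilt_zero hg n) hfg (by simp))

lemma endFilt_eq_zero {W : ℤ → Submodule ℚ V} (hW : IsFiniteFiltration W) :
    ∃ K : ℕ, ∀ f ∈ endFilt W (-K), f = 0 := by
  obtain ⟨-, ⟨a, ha⟩, b, hb⟩ := hW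
  refine ⟨(b - a).toNat, fun f hf => LinearMap.ext fun x => ?_⟩
  have := hf b x (by rw [hb b le_rfl]; trivial)
  rw [ha _ (by omega)] at this
  simpa using this

lemma isNilpotent_of_mem_endFilt {W : ℤ → Submodule ℚ V} (hW : IsFiniteFiltration W)
    {f : Module.End ℚ V} (hf : f ∈ endFilt W (-1)) : IsNilpotent f := by
  obtain ⟨K, hK⟩ := endFilt_eq_zero hW
  exact ⟨K, hK _ (by simpa using pow_mem_endFilt hf K)⟩

lemma inv_mem_endFilt [FiniteDimensional ℚ V] {W : ℤ → Submodule ℚ V}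
    (g : (Module.End ℚ V)ˣ) (hg : (g : Module.End ℚ V) ∈ endFilt W 0) :
    ((g⁻¹ : (Module.End ℚ V)ˣ) : Module.End ℚ V) ∈ endFilt W 0 := by
  intro w x hx
  have h1 : ∀ y : V, (g⁻¹ : (Module.End ℚ V)ˣ).1 (g.1 y) = y := fun y => by
    rw [← Module.End.mul_apply, Units.inv_mul, Module.End.one_apply]
  have hinj : Function.Injective g.1 := Function.LeftInverse.injective h1
  have hle : Submodule.map g.1 (W w) ≤ W w := by
    rintro _ ⟨y, hy, rfl⟩
    simpa using hg w y hy
  have heq : Submodule.map g.1 (W w) = W w :=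
    Submodule.eq_of_le_of_finrank_eq hle
      (Submodule.equivMapOfInjective g.1 hinj (W w)).symm.finrank_eq
  rw [← heq] at hx
  obtain ⟨y, hy, rfl⟩ := hx
  rw [h1]
  simpa using hy

lemma adE_mem_endFilt {W : ℤ → Submodule ℚ V} {N f : Module.End ℚ V} {k : ℤ}
    (hN : N ∈ endFilt W 0) (hf : f ∈ endFilt W k) : adE N f ∈ endFilt W k :=
  sub_mem (mul_mem_endFilt hN hf (by simp)) (mul_mem_endFilt hf hN (by simp))

lemma adE_pow_mem_endFilt {W : ℤ → Submodule ℚ V} {N f : Module.End ℚ V} {k : ℤ}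
    (hN : N ∈ endFilt W 0) (hf : f ∈ endFilt W k) (n : ℕ) : (adE N ^ n) f ∈ endFilt W k := by
  induction n with
  | zero => simpa using hf
  | succ n ih =>
    rw [pow_succ']
    exact adE_mem_endFilt hN ih

lemma adE_pow_sub_mem_endFilt {W : ℤ → Submodule ℚ V} {N M f : Module.End ℚ V} {k : ℤ}
    (hN : N ∈ endFilt W 0) (hM : M ∈ endFilt W 0) (hNM : N - M ∈ endFilt W (-1))
    (hf : f ∈ endFilt W k) (n : ℕ) : (adE N ^ n) f - (adE M ^ n) f ∈ endFilt W (k - 1) := by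
  induction n with
  | zero => simp
  | succ n ih =>
    have hM' := adE_pow_mem_endFilt hM hf n
    rw [pow_succ', pow_succ', Module.End.mul_apply, Module.End.mul_apply]
    have : adE N ((adE N ^ n) f) - adE M ((adE M ^ n) f) =
        adE N ((adE N ^ n) f - (adE M ^ n) f) +
          ((N - M) * (adE M ^ n) f - (adE M ^ n) f * (N - M)) := by
      simp only [adE_apply]
      noncomm_ring
    rw [this]
    exact add_mem (adE_mem_endFilt hN ih)
      (sub_mem (mul_mem_endFilt hNM hM' (by ring)) (mul_mem_endFilt hM' hNM (by ring)))

lemma adE_pow_conj (k : (Module.End ℚ V)ˣ) (N f : Module.End ℚ V) (n : ℕ) :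
    (adE (k⁻¹.1 * N * k.1) ^ n) (k⁻¹.1 * f * k.1) = k⁻¹.1 * (adE N ^ n) f * k.1 := by
  induction n with
  | zero => simp
  | succ n ih =>
    rw [pow_succ', pow_succ', Module.End.mul_apply, Module.End.mul_apply, ih]
    simp only [adE_apply, mul_sub, sub_mul, mul_assoc, Units.mul_inv_cancel_left]

end EndFilt

section Grading

variable {V : Type*} [AddCommGroup V] [Module ℚ V]

/-- `P m` is the projector onto the summand `U m` of the decomposition `V = ⊕ U m`. -/
structure IsGradingProj (U : ℤ → Submodule ℚ V) (P : ℤ → Module.End ℚ V) : Prop where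
  iSup_eq_top : ⨆ m, U m = ⊤
  apply_self : ∀ m, ∀ x ∈ U m, P m x = x
  apply_of_ne : ∀ m n, m ≠ n → ∀ x ∈ U m, P n x = 0
  glue : ∀ φ : ℤ → Module.End ℚ V, ∃ f : Module.End ℚ V, ∀ m, f * P m = φ m * P m

namespace IsGradingProj

variable {U : ℤ → Submodule ℚ V} {P : ℤ → Module.End ℚ V} {W : ℤ → Submodule ℚ V}

lemma ext_apply (hP : IsGradingProj U P) {f g : Module.End ℚ V}
    (h : ∀ m, ∀ x ∈ U m, f x = g x) : f = g := by
  have : (⊤ : Submodule ℚ V) ≤ LinearMap.eqLocus f g := by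
    rw [← hP.iSup_eq_top]
    exact iSup_le fun m x hx => h m x hx
  exact LinearMap.ext fun x => this (Submodule.mem_top : x ∈ ⊤)

lemma ext (hP : IsGradingProj U P) {f g : Module.End ℚ V} (h : ∀ m, f * P m = g * P m) :
    f = g := by
  refine hP.ext_apply fun m x hx => ?_
  have := LinearMap.congr_fun (h m) x
  simpa [hP.apply_self m x hx] using this

lemma mem (hP : IsGradingProj U P) (m : ℤ) (x : V) : P m x ∈ U m := by
  have : (⊤ : Submodule ℚ V) ≤ (U m).comap (P m) := by
    rw [← hP.iSup_eq_top]
    refine iSup_le fun n y hy => ?_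
    rw [Submodule.mem_comap]
    rcases eq_or_ne n m with rfl | h
    · rwa [hP.apply_self _ _ hy]
    · rw [hP.apply_of_ne _ _ h _ hy]
      exact zero_mem _
  exact this (Submodule.mem_top : x ∈ ⊤)

lemma mul_self (hP : IsGradingProj U P) (m : ℤ) : P m * P m = P m :=
  LinearMap.ext fun x => hP.apply_self _ _ (hP.mem m x)

lemma mul_of_ne (hP : IsGradingProj U P) {m n : ℤ} (h : m ≠ n) : P n * P m = 0 :=
  LinearMap.ext fun x => hP.apply_of_ne _ _ h _ (hP.mem m x)

lemma splitting_mono (hs : IsSplitting W U) : Monotone W := by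
  intro a b hab
  rw [hs.2, hs.2]
  exact biSup_mono fun n hn => hn.trans hab

lemma le_of_splitting (hs : IsSplitting W U) {m n : ℤ} (h : m ≤ n) : U m ≤ W n := by
  rw [hs.2]
  exact le_biSup U h

lemma apply_eq_zero (hP : IsGradingProj U P) (hs : IsSplitting W U) {k n : ℤ} (h : k < n)
    {x : V} (hx : x ∈ W k) : P n x = 0 := by
  have : W k ≤ LinearMap.ker (P n) := by
    rw [hs.2]
    exact iSup₂_le fun m hm y hy => hP.apply_of_ne _ _ (by omega) _ hy
  exact this hx

lemma apply_sub_mem (hP : IsGradingProj U P) (hs : IsSplitting W U) {n : ℤ} {x : V}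
    (hx : x ∈ W n) : P n x - x ∈ W (n - 1) := by
  have : W n ≤ (W (n - 1)).comap (P n - 1) := by
    conv_lhs => rw [hs.2]
    refine iSup₂_le fun m hm y hy => ?_
    rw [Submodule.mem_comap, LinearMap.sub_apply, Module.End.one_apply]
    rcases eq_or_ne m n with rfl | h
    · rw [hP.apply_self _ _ hy, sub_self]
      exact zero_mem _
    · rw [hP.apply_of_ne _ _ h _ hy, zero_sub]
      exact neg_mem (le_of_splitting hs (by omega) hy)
  exact this hx

lemma mem_pred (hP : IsGradingProj U P) (hs : IsSplitting W U) {n : ℤ} {x : V}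
    (hx : x ∈ W n) (h0 : P n x = 0) : x ∈ W (n - 1) := by
  have := hP.apply_sub_mem hs hx
  rw [h0, zero_sub] at this
  exact (neg_mem_iff).1 this

/-- Each projector of a grading compatible with `W` preserves `W`. -/
lemma mem_endFilt_of_compatible (hP : IsGradingProj U P)
    (hc : ∀ w : ℤ, W w = ⨆ n : ℤ, W w ⊓ U n) (n : ℤ) : P n ∈ endFilt W 0 := by
  intro w x hx
  rw [add_zero]
  have : W w ≤ (W w).comap (P n) := by
    conv_lhs => rw [hc]
    refine iSup_le fun m y hy => ?_
    rw [Submodule.mem_comap]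
    rcases eq_or_ne m n with rfl | h
    · rw [hP.apply_self _ _ hy.2]
      exact hy.1
    · rw [hP.apply_of_ne _ _ h _ hy.2]
      exact zero_mem _
  exact this hx

end IsGradingProj

lemma exists_isGradingProj {U : ℤ → Submodule ℚ V} (hU : DirectSum.IsInternal U) :
    ∃ P, IsGradingProj U P := by
  let e := LinearEquiv.ofBijective (DirectSum.coeLinearMap U) hU
  have he : ∀ m (x : U m), e.symm (x : V) = DirectSum.lof ℚ ℤ (fun m => U m) m x := by
    intro m x
    rw [LinearEquiv.symm_apply_eq]
    exact (DirectSum.coeLinearMap_lof U m x).symm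
  have hglue : ∀ φ : ℤ → Module.End ℚ V, ∃ f : Module.End ℚ V, ∀ m, ∀ x ∈ U m,
      f x = φ m x := by
    intro φ
    refine ⟨(DirectSum.toModule ℚ ℤ V fun m => φ m ∘ₗ (U m).subtype) ∘ₗ e.symm.toLinearMap,
      fun m x hx => ?_⟩
    have := he m ⟨x, hx⟩
    simp only at this
    simp [this]
  choose P hP using fun n : ℤ => hglue fun m => if m = n then 1 else 0
  have hsup := hU.submodule_iSup_eq_top
  have hmem : ∀ m x, P m x ∈ U m := by
    intro m x
    have : (⊤ : Submodule ℚ V) ≤ (U m).comap (P m) := by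
      rw [← hsup]
      refine iSup_le fun n y hy => ?_
      rw [Submodule.mem_comap, hP _ _ _ hy]
      split_ifs with h
      · simpa [← h] using hy
      · simp
    exact this (Submodule.mem_top : x ∈ ⊤)
  refine ⟨P, hsup, fun m x hx => by simp [hP _ _ _ hx], fun m n h x hx => by simp [hP _ _ _ hx, h],
    fun φ => ?_⟩
  obtain ⟨f, hf⟩ := hglue φ
  exact ⟨f, fun m => LinearMap.ext fun x => hf m _ (hmem m x)⟩

end Grading

section Homogeneous

variable {V : Type*} [AddCommGroup V] [Module ℚ V]

/-- `f` has weight `k` for the grading with projectors `P`. -/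
def IsHomogeneousEnd (P : ℤ → Module.End ℚ V) (k : ℤ) (f : Module.End ℚ V) : Prop :=
  ∀ m, f * P m = P (m + k) * f

namespace IsHomogeneousEnd

variable {P : ℤ → Module.End ℚ V} {a b k : ℤ} {f g : Module.End ℚ V}

lemma mul (hf : IsHomogeneousEnd P a f) (hg : IsHomogeneousEnd P b g) :
    IsHomogeneousEnd P (a + b) (f * g) := by
  intro m
  rw [mul_assoc, hg m, ← mul_assoc, hf, mul_assoc, show m + b + a = m + (a + b) by ring]

lemma sub (hf : IsHomogeneousEnd P a f) (hg : IsHomogeneousEnd P a g) :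
    IsHomogeneousEnd P a (f - g) := by
  intro m
  rw [sub_mul, mul_sub, hf, hg]

lemma pow (hf : IsHomogeneousEnd P a f) (n : ℕ) : IsHomogeneousEnd P (n * a) (f ^ n) := by
  induction n with
  | zero => intro m; simp
  | succ n ih =>
    rw [pow_succ]
    convert ih.mul hf using 1
    push_cast
    ring

lemma adE_pow (hf : IsHomogeneousEnd P a f) (hg : IsHomogeneousEnd P b g) (n : ℕ) :
    IsHomogeneousEnd P (b + n * a) ((adE f ^ n) g) := by
  induction n with
  | zero => simpa using hg
  | succ n ih =>
    rw [pow_succ', Module.End.mul_apply, adE_apply]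
    have h1 := hf.mul ih
    have h2 := ih.mul hf
    rw [show a + (b + n * a) = b + (n + 1 : ℕ) * a by push_cast; ring] at h1
    rw [show b + n * a + a = b + (n + 1 : ℕ) * a by push_cast; ring] at h2
    exact h1.sub h2

end IsHomogeneousEnd

namespace IsGradingProj

variable {U U' W W' : ℤ → Submodule ℚ V} {P P' : ℤ → Module.End ℚ V} {f N : Module.End ℚ V} {k : ℤ}

lemma isHomogeneousEnd (hP : IsGradingProj U P) (h : ∀ m, ∀ x ∈ U m, f x ∈ U (m + k)) :
    IsHomogeneousEnd P k f := by
  intro m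
  refine hP.ext_apply fun n x hx => ?_
  rw [Module.End.mul_apply, Module.End.mul_apply]
  rcases eq_or_ne n m with rfl | hn
  · rw [hP.apply_self _ _ hx, hP.apply_self _ _ (h _ _ hx)]
  · rw [hP.apply_of_ne _ _ hn _ hx, hP.apply_of_ne _ _ (by omega) _ (h _ _ hx), map_zero]

lemma apply_mem (hP : IsGradingProj U P) (h : IsHomogeneousEnd P k f) {m : ℤ} {x : V}
    (hx : x ∈ U m) : f x ∈ U (m + k) := by
  have := LinearMap.congr_fun (h m) x
  rw [Module.End.mul_apply, Module.End.mul_apply, hP.apply_self _ _ hx] at this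
  rw [this]
  exact hP.mem _ _

lemma mem_endFilt (hP : IsGradingProj U P) (hs : IsSplitting W U) (h : IsHomogeneousEnd P k f) :
    f ∈ endFilt W k := by
  intro w x hx
  have : W w ≤ (W (w + k)).comap f := by
    conv_lhs => rw [hs.2]
    exact iSup₂_le fun m hm y hy => le_of_splitting hs (by omega) (hP.apply_mem h hy)
  exact this hx

lemma mem_endFilt_pred (hP : IsGradingProj U P) (hs : IsSplitting W U) (hf : f ∈ endFilt W k)
    (h : ∀ m, P (m + k) * f * P m = 0) : f ∈ endFilt W (k - 1) := by
  intro w x hx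
  have : W w ≤ (W (w + (k - 1))).comap f := by
    conv_lhs => rw [hs.2]
    refine iSup₂_le fun m hm y hy => ?_
    have h0 := LinearMap.congr_fun (h m) y
    rw [Module.End.mul_apply, Module.End.mul_apply, hP.apply_self _ _ hy] at h0
    exact splitting_mono hs (by omega)
      (hP.mem_pred hs (hf m y (le_of_splitting hs le_rfl hy)) h0)
  exact this hx

lemma mul_mul_eq_zero (hP : IsGradingProj U P) (hs : IsSplitting W U) {l : ℤ}
    (hf : f ∈ endFilt W l) (hl : l < k) (m : ℤ) : P (m + k) * f * P m = 0 :=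
  LinearMap.ext fun x => hP.apply_eq_zero hs (by omega)
    (hf m _ (le_of_splitting hs le_rfl (hP.mem m x)))

lemma mul_mul_of_isHomogeneousEnd (hP : IsGradingProj U P) (h : IsHomogeneousEnd P k f) (m : ℤ) :
    P (m + k) * f * P m = f * P m := by
  rw [← h, mul_assoc, hP.mul_self]

lemma exists_component (hP : IsGradingProj U P) (f : Module.End ℚ V) (k : ℤ) :
    ∃ g, IsHomogeneousEnd P k g ∧ ∀ m, g * P m = P (m + k) * f * P m := by
  obtain ⟨g, hg⟩ := hP.glue fun m => P (m + k) * f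
  refine ⟨g, fun m => hP.ext fun n => ?_, hg⟩
  rcases eq_or_ne n m with rfl | hn
  · rw [mul_assoc, hP.mul_self, mul_assoc, hg, ← mul_assoc, ← mul_assoc, hP.mul_self]
  · rw [mul_assoc, hP.mul_of_ne hn, mul_assoc, hg, ← mul_assoc, ← mul_assoc,
      hP.mul_of_ne (by omega)]
    simp

lemma weightDecomp_isHomogeneousEnd (hP : IsGradingProj U P) {c : ℤ → Module.End ℚ V}
    (hc : IsWeightDecomp U f c) (w : ℤ) : IsHomogeneousEnd P w (c w) :=
  hP.isHomogeneousEnd fun m x hx => hc.2.2 w m x hx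

lemma weightDecomp_mul (hP : IsGradingProj U P) {c : ℤ → Module.End ℚ V}
    (hc : IsWeightDecomp U f c) (w m : ℤ) : P (m + w) * f * P m = c w * P m := by
  have hh := hP.weightDecomp_isHomogeneousEnd hc
  rw [← hc.2.1, finsum_eq_sum_of_support_subset (s := insert w hc.1.toFinset) c (by simp),
    Finset.mul_sum, Finset.sum_mul, Finset.sum_eq_single w]
  · exact hP.mul_mul_of_isHomogeneousEnd (hh w) m
  · intro v _ hv
    rw [mul_assoc, hh v m, ← mul_assoc, hP.mul_of_ne (by omega), zero_mul]
  · simp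

lemma commute (hP : IsGradingProj U P) (hP' : IsGradingProj U' P')
    (h : DirectSum.IsInternal fun p : ℤ × ℤ => U p.1 ⊓ U' p.2) (m n : ℤ) :
    P m * P' n = P' n * P m := by
  have : (⊤ : Submodule ℚ V) ≤ LinearMap.eqLocus (P m * P' n) (P' n * P m) := by
    rw [← h.submodule_iSup_eq_top]
    refine iSup_le fun p x hx => ?_
    have h1 : ∀ n, P' n x = if p.2 = n then x else 0 := fun n => by
      split_ifs with h
      · exact hP'.apply_self _ _ (h ▸ hx.2)
      · exact hP'.apply_of_ne _ _ h _ hx.2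
    have h2 : ∀ m, P m x = if p.1 = m then x else 0 := fun n => by
      split_ifs with h
      · exact hP.apply_self _ _ (h ▸ hx.1)
      · exact hP.apply_of_ne _ _ h _ hx.1
    rw [LinearMap.mem_eqLocus, Module.End.mul_apply, Module.End.mul_apply, h1, h2]
    split_ifs <;> simp [*]
  exact LinearMap.ext fun x => this (Submodule.mem_top : x ∈ ⊤)

/-- A bihomogeneous endomorphism whose class in the bigraded piece of its weight is zero
vanishes. -/
lemma eq_zero_of_mem_grSub (hP : IsGradingProj U P) (hP' : IsGradingProj U' P')
    (hs : IsSplitting W U) (hs' : IsSplitting W' U') (hcomm : ∀ m n, P m * P' n = P' n * P m)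
    {w : ℤ} (hf : IsHomogeneousEnd P w f) (hf' : IsHomogeneousEnd P' k f)
    (h : f ∈ grSub (endFilt W) (endFilt W') w (k - 1)) : f = 0 := by
  obtain ⟨a, ha, b, hb, rfl⟩ := Submodule.mem_sup.1 h
  have ha' : a ∈ endFilt W' (k - 1) := ha.1
  refine hP.ext fun m => hP'.ext fun n => LinearMap.ext fun x => ?_
  have hx : P m (P' n x) ∈ U m := hP.mem _ _
  have hx' : P m (P' n x) ∈ U' n := by
    have := LinearMap.congr_fun (hcomm m n) x
    rw [Module.End.mul_apply] at this
    rw [this]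
    exact hP'.mem _ _
  simp only [zero_mul, LinearMap.zero_apply, Module.End.mul_apply]
  set y := P m (P' n x)
  have h1 : P' (n + k) (a y) = 0 :=
    hP'.apply_eq_zero hs' (by omega) (ha' n y (le_of_splitting hs' le_rfl hx'))
  have h2 : P (m + w) (b y) = 0 :=
    hP.apply_eq_zero hs (by omega) (hb m y (le_of_splitting hs le_rfl hx))
  have h3 := LinearMap.congr_fun (hcomm (m + w) (n + k)) (b y)
  simp only [Module.End.mul_apply, h2, map_zero] at h3
  rw [← hP.apply_self _ _ (hP.apply_mem hf hx), ← hP'.apply_self _ _ (hP'.apply_mem hf' hx'),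
    LinearMap.add_apply, map_add, h1, zero_add, h3]

section Deligne

variable {c : ℤ → Module.End ℚ V}

lemma weightDecomp_isHomogeneousEnd_snd (hP : IsGradingProj U P)
    (hcomm : ∀ m n, P m * P' n = P' n * P m)
    (hN' : IsHomogeneousEnd P' k N) (hc : IsWeightDecomp U N c) (w : ℤ) :
    IsHomogeneousEnd P' k (c w) := by
  intro n
  refine hP.ext fun m => ?_
  have h := hP.weightDecomp_mul hc w m
  rw [mul_assoc, ← hcomm, ← mul_assoc, ← h, mul_assoc (P' (n + k)), ← h]
  rw [mul_assoc, hcomm, mul_assoc, ← mul_assoc N, hN', ← mul_assoc, ← mul_assoc, hcomm]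
  simp only [mul_assoc]

lemma sub_weightDecomp_mem (hP : IsGradingProj U P) (hs : IsSplitting W U)
    (hN : N ∈ endFilt W 0) (hc : IsWeightDecomp U N c) : N - c 0 ∈ endFilt W (-1) := by
  have hc0 := hP.weightDecomp_isHomogeneousEnd hc 0
  refine hP.mem_endFilt_pred hs (sub_mem hN (hP.mem_endFilt hs hc0)) fun m => ?_
  rw [mul_sub, sub_mul, hP.weightDecomp_mul hc, hP.mul_mul_of_isHomogeneousEnd hc0, sub_self]

/-- For the Deligne splitting, the primitivity conditions hold exactly, not only up to
lower order terms. -/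
lemma adE_pow_weightDecomp_eq_zero (hP : IsGradingProj U P) (hP' : IsGradingProj U' P')
    (hs' : IsSplitting W' U') (hN : N ∈ endFilt W 0) (hN' : IsHomogeneousEnd P' (-2) N)
    (hD : IsDeligneSplitting N W W' U' U) (hc : IsWeightDecomp U N c) (j : ℕ) :
    (adE (c 0) ^ j) (c (-(j + 1))) = 0 := by
  have hs := hD.1
  have hcomm := hP.commute hP' hD.2.1
  have hh := hP.weightDecomp_isHomogeneousEnd hc
  have hh' := hP.weightDecomp_isHomogeneousEnd_snd hcomm hN' hc
  obtain ⟨h1, h2⟩ := hD.2.2 c hc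
  rcases Nat.eq_zero_or_pos j with rfl | hj
  · simpa using hP.eq_zero_of_mem_grSub hP' hs hs' hcomm (hh (-1)) (hh' (-1)) h1
  · obtain ⟨-, h3⟩ := h2 (-(j + 1)) (by omega)
    rw [show (-(-((j : ℤ) + 1)) - 1).toNat = j by omega] at h3
    have h4 := (hh 0).adE_pow (hh (-(j + 1))) j
    have h5 := (hh' 0).adE_pow (hh' (-(j + 1))) j
    rw [mul_zero, add_zero] at h4
    refine hP.eq_zero_of_mem_grSub hP' hs hs' hcomm h4 h5 ?_
    have h6 := adE_pow_sub_mem_endFilt hN (hP.mem_endFilt hs (hh 0))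
      (hP.sub_weightDecomp_mem hs hN hc) (hP.mem_endFilt hs (hh (-(j + 1)))) j
    rw [show (-2 : ℤ) + j * -2 - 1 = 2 * -((j : ℤ) + 1) - 1 by ring]
    have h7 := sub_mem h3 (Submodule.mem_sup_right h6 :
      _ ∈ grSub (endFilt W) (endFilt W') (-((j : ℤ) + 1)) (2 * -((j : ℤ) + 1) - 1))
    rwa [sub_sub_cancel] at h7

/-- Hard Lefschetz for the action of the weight zero component of `N` on `End V`. -/
lemma eq_zero_of_adE_pow_weightDecomp (hP : IsGradingProj U P) (hP' : IsGradingProj U' P')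
    (hs' : IsSplitting W' U') (hN : N ∈ endFilt W 0) (hN' : IsHomogeneousEnd P' (-2) N)
    (h : IsRelMonFil N W W')
    (hD : IsDeligneSplitting N W W' U' U) (hc : IsWeightDecomp U N c) (j : ℕ)
    (hf : IsHomogeneousEnd P (-j) f) (hf' : IsHomogeneousEnd P' 0 f)
    (had : (adE (c 0) ^ j) f = 0) : f = 0 := by
  have hs := hD.1
  have hcomm := hP.commute hP' hD.2.1
  have hh := hP.weightDecomp_isHomogeneousEnd hc 0
  have hh' := hP.weightDecomp_isHomogeneousEnd_snd hcomm hN' hc 0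
  have hc0 := hP.mem_endFilt hs hh
  have hpow := pow_sub_pow_mem_endFilt hN hc0 (hP.sub_weightDecomp_mem hs hN hc)
  have hnil : IsNilpotent (c 0) :=
    isNilpotent_of_mem_endFilt h.1 (endFilt_mono h.1.1 (by norm_num) (hP'.mem_endFilt hs' hh'))
  have happ : ∀ m n x, P m (P' n x) = P' n (P m x) := fun m n x =>
    LinearMap.congr_fun (hcomm m n) x
  have hdrop : ∀ w n x, x ∈ grSub W W' w (n - 1) → P' n (P w x) = 0 := by
    intro w n x hx
    obtain ⟨y, hy, z, hz, rfl⟩ := Submodule.mem_sup.1 hx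
    rw [map_add, map_add, hP.apply_eq_zero hs (by omega) hz, ← happ,
      hP'.apply_eq_zero hs' (by omega) hy.1, map_zero, map_zero, add_zero]
  refine eq_zero_of_adE_pow_eq_zero (c 0) f hnil (fun w d => U w ⊓ U' (w + d)) ?_ ?_ ?_ ?_ j ?_ had
  · rw [eq_top_iff, ← hD.2.1.submodule_iSup_eq_top]
    refine iSup_le fun p => le_iSup_of_le p.1 (le_iSup_of_le (p.2 - p.1) ?_)
    rw [add_sub_cancel]
  · intro w d x hx
    refine ⟨by simpa using hP.apply_mem hh hx.1, ?_⟩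
    have := hP'.apply_mem hh' hx.2
    rwa [show w + d + -2 = w + (d - 2) by ring] at this
  · intro w m x hx h0
    have hxW := le_of_splitting hs le_rfl hx.1
    have h1 : (N ^ m) x ∈ W (w - 1) := by
      have := hpow m w x hxW
      rwa [LinearMap.sub_apply, h0, sub_zero] at this
    have h2 := (h.2.2 w m).2.2.1 x
      (Submodule.mem_sup_left ⟨le_of_splitting hs' le_rfl hx.2, hxW⟩) (Submodule.mem_sup_right h1)
    have h3 := hdrop _ _ _ h2
    rwa [hP.apply_self _ _ hx.1, hP'.apply_self _ _ hx.2] at h3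
  · intro w m y hy
    have hy' : y ∈ grSub W W' w (w - m) :=
      Submodule.mem_sup_left ⟨le_of_splitting hs' (by omega) hy.2, le_of_splitting hs le_rfl hy.1⟩
    obtain ⟨_, ⟨x, hx, rfl⟩, z, hz, hxz⟩ := Submodule.mem_sup.1 ((h.2.2 w m).2.2.2 hy')
    have hxW : x ∈ W w := by
      have : grSub W W' w (w + m) ≤ W w := sup_le inf_le_right (splitting_mono hs (by omega))
      exact this hx
    refine ⟨P' (w + m) (P w x), ⟨?_, hP'.mem _ _⟩, ?_⟩
    · rw [← happ]
      exact hP.mem _ _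
    have h1 : P w ((N ^ m) x) = P w ((c 0 ^ m) x) := by
      have := hP.apply_eq_zero hs (show w + -1 < w by omega) (hpow m w x hxW)
      rwa [LinearMap.sub_apply, map_sub, sub_eq_zero] at this
    have h2 := LinearMap.congr_fun (hh.pow m w) x
    have h3 := LinearMap.congr_fun (hh'.pow m (w + m)) (P w x)
    simp only [Module.End.mul_apply, mul_zero, add_zero] at h2 h3
    rw [h3, h2, ← h1, show w + (m : ℤ) + m * -2 = w - m by ring]
    have h4 := hdrop _ _ _ hz
    have h5 : P' (w - m) (P w y) = y := by
      rw [hP.apply_self _ _ hy.1]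
      exact hP'.apply_self _ _ hy.2
    rw [← h5, ← hxz, map_add, map_add, h4, add_zero]
  · intro w d x hx
    have h1 := hP.apply_mem hf hx.1
    have h2 := hP'.apply_mem hf' hx.2
    refine ⟨h1, ?_⟩
    rwa [show w + d + 0 = w - j + (d + j) by ring] at h2

end Deligne

end IsGradingProj

end Homogeneous

section Uniqueness

variable {V : Type*} [AddCommGroup V] [Module ℚ V]

/-- Rigidity of the Deligne splitting: an automorphism `h`, unipotent for `W`, commuting with the
grading of `W'` and intertwining `N` with an `N'` satisfying the same primitivity conditions,
is trivial. -/
lemma eq_one_of_primitive {U W : ℤ → Submodule ℚ V} {P P' : ℤ → Module.End ℚ V}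
    {N N' h : Module.End ℚ V} {c c' : ℤ → Module.End ℚ V}
    (hW : IsFiniteFiltration W) (hs : IsSplitting W U) (hP : IsGradingProj U P)
    (hcomm : ∀ m n, P m * P' n = P' n * P m)
    (hh : h - 1 ∈ endFilt W (-1)) (hhP' : ∀ n, h * P' n = P' n * h) (hNh : N * h = h * N')
    (hN : N ∈ endFilt W 0) (hN' : N' ∈ endFilt W 0)
    (hcN : ∀ w m, P (m + w) * N * P m = c w * P m)
    (hcN' : ∀ w m, P (m + w) * N' * P m = c' w * P m)
    (hprim : ∀ j : ℕ, (adE (c 0) ^ j) (c (-(j + 1))) = 0)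
    (hprim' : ∀ j : ℕ, (adE (c' 0) ^ j) (c' (-(j + 1))) = 0)
    (hLef : ∀ (j : ℕ) (f : Module.End ℚ V), IsHomogeneousEnd P (-j) f → IsHomogeneousEnd P' 0 f →
      (adE (c 0) ^ j) f = 0 → f = 0) : h = 1 := by
  have hc0 : c' 0 = c 0 := by
    refine hP.ext fun m => ?_
    have h1 : N - N' ∈ endFilt W (-1) := by
      rw [show N - N' = (h - 1) * N' - N * (h - 1) by
        rw [mul_sub, hNh]; noncomm_ring]
      exact sub_mem (mul_mem_endFilt hh hN' (by simp)) (mul_mem_endFilt hN hh (by simp))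
    have h2 := hP.mul_mul_eq_zero hs h1 (show (-1 : ℤ) < 0 by norm_num) m
    rw [mul_sub, sub_mul, hcN, hcN', sub_eq_zero] at h2
    exact h2.symm
  have key : ∀ j : ℕ, h - 1 ∈ endFilt W (-((j : ℤ) + 1)) := by
    intro j
    induction j with
    | zero => simpa using hh
    | succ j ih =>
      obtain ⟨η, hη, hηP⟩ := hP.exists_component (h - 1) (-((j : ℤ) + 1))
      have hρ : h - 1 - η ∈ endFilt W (-((j : ℤ) + 1) - 1) := by
        refine hP.mem_endFilt_pred hs (sub_mem ih (hP.mem_endFilt hs hη)) fun m => ?_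
        rw [mul_sub, sub_mul, hP.mul_mul_of_isHomogeneousEnd hη, hηP, sub_self]
      have hηP' : IsHomogeneousEnd P' 0 η := by
        intro n
        rw [add_zero]
        refine hP.ext fun m => ?_
        have h1 : (h - 1) * P' n = P' n * (h - 1) := by
          rw [sub_mul, mul_sub, hhP', one_mul, mul_one]
        rw [mul_assoc, ← hcomm, ← mul_assoc, hηP, mul_assoc (P' n), hηP, mul_assoc, hcomm,
          mul_assoc, ← mul_assoc (h - 1), h1, ← mul_assoc, ← mul_assoc, hcomm]
        simp only [mul_assoc]
      have hbr : adE (c 0) η = c' (-((j : ℤ) + 1)) - c (-((j : ℤ) + 1)) := by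
        refine hP.ext fun m => ?_
        set k : ℤ := -((j : ℤ) + 1)
        have h1 : N + N * η + N * (h - 1 - η) = N' + η * N' + (h - 1 - η) * N' := by
          have e1 : N + N * η + N * (h - 1 - η) = N * h := by noncomm_ring
          have e2 : N' + η * N' + (h - 1 - η) * N' = h * N' := by noncomm_ring
          rw [e1, e2, hNh]
        have h2 := congrArg (fun f => P (m + k) * f * P m) h1
        simp only [mul_add, add_mul] at h2
        rw [hP.mul_mul_eq_zero hs (mul_mem_endFilt hN hρ rfl) (by omega),
          hP.mul_mul_eq_zero hs (mul_mem_endFilt hρ hN' rfl) (by omega), hcN, hcN',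
          add_zero, add_zero] at h2
        have h3 : P (m + k) * (N * η) * P m = c 0 * η * P m := by
          have e := hcN 0 (m + k)
          rw [add_zero] at e
          rw [mul_assoc, mul_assoc, mul_assoc, ← hP.mul_mul_of_isHomogeneousEnd hη m,
            mul_assoc (P (m + k)), ← mul_assoc N, ← mul_assoc, ← mul_assoc (P (m + k)), e,
            mul_assoc]
        have h4 : P (m + k) * (η * N') * P m = η * c 0 * P m := by
          have e := hcN' 0 m
          rw [add_zero] at e
          rw [← mul_assoc, ← hη, mul_assoc, mul_assoc, ← mul_assoc (P m), e, hc0, mul_assoc]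
        rw [h3, h4] at h2
        rw [adE_apply, sub_mul, sub_mul, sub_eq_sub_iff_add_eq_add, add_comm, h2]
      have hη0 : η = 0 := by
        refine hLef (j + 1) η (by simpa using hη) hηP' ?_
        have h5 := hprim' j
        rw [hc0] at h5
        rw [pow_succ, Module.End.mul_apply, hbr, map_sub, hprim, h5, sub_zero]
      rw [hη0, sub_zero] at hρ
      convert hρ using 2
      push_cast
      ring
  obtain ⟨K, hK⟩ := endFilt_eq_zero hW
  refine sub_eq_zero.1 (hK _ (endFilt_mono hW.1 ?_ (key K)))
  omega

/-- Two compatible splittings of `W'` for which `N` has weight `-2` are conjugate by an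
automorphism commuting with `N`, preserving `W`, and unipotent for `W'`. -/
lemma exists_conj_of_splittings {W W' U'₁ U'₂ : ℤ → Submodule ℚ V} {N : Module.End ℚ V}
    {P'₁ P'₂ : ℤ → Module.End ℚ V} (hW' : IsFiniteFiltration W')
    (hs₁ : IsSplitting W' U'₁) (hs₂ : IsSplitting W' U'₂)
    (hP₁ : IsGradingProj U'₁ P'₁) (hP₂ : IsGradingProj U'₂ P'₂)
    (hN₁ : IsHomogeneousEnd P'₁ (-2) N) (hN₂ : IsHomogeneousEnd P'₂ (-2) N)
    (hc₁ : ∀ w : ℤ, W w = ⨆ n : ℤ, W w ⊓ U'₁ n) (hc₂ : ∀ w : ℤ, W w = ⨆ n : ℤ, W w ⊓ U'₂ n) :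
    ∃ g : (Module.End ℚ V)ˣ, g.1 ∈ endFilt W 0 ∧ g.1 - 1 ∈ endFilt W' (-1) ∧
      g.1 * N = N * g.1 ∧ ∀ n, P'₂ n * g.1 = g.1 * P'₁ n := by
  obtain ⟨g, hg⟩ := hP₁.glue P'₂
  have hgu : g - 1 ∈ endFilt W' (-1) := by
    intro w x hx
    have : W' w ≤ (W' (w + -1)).comap (g - 1) := by
      conv_lhs => rw [hs₁.2]
      refine iSup₂_le fun n hn y hy => ?_
      have h1 := LinearMap.congr_fun (hg n) y
      rw [Module.End.mul_apply, Module.End.mul_apply, hP₁.apply_self _ _ hy] at h1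
      rw [Submodule.mem_comap, LinearMap.sub_apply, h1]
      exact hW'.1 (by omega)
        (hP₂.apply_sub_mem hs₂ (IsGradingProj.le_of_splitting hs₁ le_rfl hy))
    exact this hx
  have hu : IsUnit g := by
    simpa using (isNilpotent_of_mem_endFilt hW' hgu).isUnit_one_add
  obtain ⟨g, rfl⟩ := hu
  refine ⟨g, ?_, hgu, ?_, ?_⟩
  · intro w x hx
    have : W w ≤ (W (w + 0)).comap g.1 := by
      conv_lhs => rw [hc₁]
      refine iSup_le fun n y hy => ?_
      have h1 := LinearMap.congr_fun (hg n) y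
      rw [Module.End.mul_apply, Module.End.mul_apply, hP₁.apply_self _ _ hy.2] at h1
      rw [Submodule.mem_comap, h1]
      exact hP₂.mem_endFilt_of_compatible hc₂ n w y hy.1
    exact this hx
  · refine hP₁.ext fun n => ?_
    rw [mul_assoc, hN₁, ← mul_assoc, hg, mul_assoc, mul_assoc N, hg, ← hN₁, ← mul_assoc,
      ← mul_assoc, hN₂]
  · intro n
    refine hP₁.ext fun m => ?_
    rw [mul_assoc, hg, mul_assoc]
    rcases eq_or_ne m n with rfl | h
    · rw [← mul_assoc, hP₂.mul_self, hP₁.mul_self, hg]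
    · rw [hP₁.mul_of_ne h, ← mul_assoc, hP₂.mul_of_ne h, zero_mul, mul_zero]

end Uniqueness

/-- the class `N̄_w` (for `w ≤ -2`) in `gr^{W'}_{-2} gr^W_w End(V)` of the
weight-`w` component of `N` with respect to the Deligne splitting is independent of the
choice of splitting `U'` of `W'` (with `N(U'_w) ⊆ U'_{w-2}`, compatible with `W`).
Equality of the classes in `gr^{W'}_{-2} gr^W_w End(V)` is expressed by the membership of
the difference of the weight components in the denominator
`grSub (endFilt W) (endFilt W') w (-3)`. -/
theorem nbar_independent_of_splitting
    {V : Type*} [AddCommGroup V] [Module ℚ V] [FiniteDimensional ℚ V]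
    (W W' : ℤ → Submodule ℚ V) (hW : IsFiniteFiltration W)
    (N : Module.End ℚ V) (hNnil : IsNilpotent N)
    (hNW : ∀ w : ℤ, ∀ x ∈ W w, N x ∈ W w)
    (h : IsRelMonFil N W W')
    (U'₁ U'₂ : ℤ → Submodule ℚ V)
    (hU'₁ : IsSplitting W' U'₁)
    (hNU'₁ : ∀ w : ℤ, ∀ x ∈ U'₁ w, N x ∈ U'₁ (w - 2))
    (hcompat₁ : ∀ w : ℤ, W w = ⨆ n : ℤ, W w ⊓ U'₁ n)
    (hU'₂ : IsSplitting W' U'₂)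
    (hNU'₂ : ∀ w : ℤ, ∀ x ∈ U'₂ w, N x ∈ U'₂ (w - 2))
    (hcompat₂ : ∀ w : ℤ, W w = ⨆ n : ℤ, W w ⊓ U'₂ n)
    (U₁ U₂ : ℤ → Submodule ℚ V)
    (hD₁ : IsDeligneSplitting N W W' U'₁ U₁)
    (hD₂ : IsDeligneSplitting N W W' U'₂ U₂)
    (c₁ c₂ : ℤ → Module.End ℚ V)
    (hc₁ : IsWeightDecomp U₁ N c₁) (hc₂ : IsWeightDecomp U₂ N c₂) :
    ∀ w : ℤ, w ≤ -2 → c₁ w - c₂ w ∈ grSub (endFilt W) (endFilt W') w (-3) := by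
  intro w _
  obtain ⟨P₁, hP₁⟩ := exists_isGradingProj hD₁.1.1
  obtain ⟨P₂, hP₂⟩ := exists_isGradingProj hD₂.1.1
  obtain ⟨P'₁, hP'₁⟩ := exists_isGradingProj hU'₁.1
  obtain ⟨P'₂, hP'₂⟩ := exists_isGradingProj hU'₂.1
  have hs₁ := hD₁.1
  have hs₂ := hD₂.1
  have hN₁ : IsHomogeneousEnd P'₁ (-2) N := hP'₁.isHomogeneousEnd hNU'₁
  have hN₂ : IsHomogeneousEnd P'₂ (-2) N := hP'₂.isHomogeneousEnd hNU'₂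
  have hN : N ∈ endFilt W 0 := fun w x hx => by simpa using hNW w x hx
  have hcomm₁ := hP₁.commute hP'₁ hD₁.2.1
  have hcomm₂ := hP₂.commute hP'₂ hD₂.2.1
  have hh₁ := hP₁.weightDecomp_isHomogeneousEnd hc₁
  have hh₂ := hP₂.weightDecomp_isHomogeneousEnd hc₂
  obtain ⟨g, hgW, hgW', hgN, hgP'⟩ :=
    exists_conj_of_splittings h.1 hU'₁ hU'₂ hP'₁ hP'₂ hN₁ hN₂ hcompat₁ hcompat₂
  have hgiW := inv_mem_endFilt g hgW
  have hg0 : g.1 ∈ endFilt W' 0 := by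
    simpa using add_mem (endFilt_mono h.1.1 (show (-1 : ℤ) ≤ 0 by norm_num) hgW')
      (one_mem_endFilt W')
  have hgiW' := inv_mem_endFilt g hg0
  have hgP'i : ∀ n, g⁻¹.1 * P'₂ n = P'₁ n * g⁻¹.1 := by
    intro n
    rw [Units.inv_mul_eq_iff_eq_mul, ← mul_assoc, ← hgP', mul_assoc, Units.mul_inv, mul_one]
  -- `q` carries the second Deligne splitting to the `g`-translate of the first one
  obtain ⟨q, hq⟩ := hP₂.glue fun m => g.1 * P₁ m * g⁻¹.1
  have hq1 : q - 1 ∈ endFilt W (-1) := by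
    intro w x hx
    have : W w ≤ (W (w + -1)).comap (q - 1) := by
      conv_lhs => rw [hs₂.2]
      refine iSup₂_le fun n hn y hy => ?_
      have h1 := LinearMap.congr_fun (hq n) y
      simp only [Module.End.mul_apply, hP₂.apply_self _ _ hy] at h1
      rw [Submodule.mem_comap, LinearMap.sub_apply, h1, Module.End.one_apply]
      have h2 := hgiW n y (IsGradingProj.le_of_splitting hs₂ le_rfl hy)
      rw [add_zero] at h2
      have h3 := hgW _ _ (hP₁.apply_sub_mem hs₁ h2)
      rw [map_sub, ← Module.End.mul_apply g.1 g⁻¹.1, Units.mul_inv, Module.End.one_apply] at h3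
      exact hW.1 (by omega) h3
    exact this hx
  have hqu : IsUnit q := by
    simpa using (isNilpotent_of_mem_endFilt hW hq1).isUnit_one_add
  obtain ⟨q, rfl⟩ := hqu
  have hq0 : q.1 ∈ endFilt W 0 := by
    simpa using add_mem (endFilt_mono hW.1 (show (-1 : ℤ) ≤ 0 by norm_num) hq1)
      (one_mem_endFilt W)
  have hqP' : ∀ n, q.1 * P'₂ n = P'₂ n * q.1 := by
    intro n
    refine hP₂.ext fun m => ?_
    calc q.1 * P'₂ n * P₂ m = q.1 * P₂ m * P'₂ n := by rw [mul_assoc, ← hcomm₂, mul_assoc]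
      _ = g.1 * P₁ m * g⁻¹.1 * (P'₂ n * P₂ m) := by rw [hq, mul_assoc, hcomm₂]
      _ = g.1 * (P₁ m * (g⁻¹.1 * P'₂ n)) * P₂ m := by simp only [mul_assoc]
      _ = g.1 * ((P₁ m * P'₁ n) * g⁻¹.1) * P₂ m := by rw [hgP'i]; simp only [mul_assoc]
      _ = g.1 * P'₁ n * (P₁ m * g⁻¹.1 * P₂ m) := by rw [hcomm₁]; simp only [mul_assoc]
      _ = P'₂ n * (g.1 * P₁ m * g⁻¹.1 * P₂ m) := by rw [← hgP']; simp only [mul_assoc]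
      _ = P'₂ n * q.1 * P₂ m := by rw [← hq, mul_assoc]
  let k := g⁻¹ * q
  have hkP : ∀ m, k.1 * P₂ m = P₁ m * k.1 := by
    have h1 : ∀ m, k.1 * P₂ m = P₁ m * g⁻¹.1 * P₂ m := by
      intro m
      simp only [k, Units.val_mul]
      rw [mul_assoc, hq, ← mul_assoc, ← mul_assoc, ← mul_assoc, Units.inv_mul, one_mul]
    intro m
    refine hP₂.ext fun n => ?_
    rw [mul_assoc, mul_assoc, h1 n]
    rcases eq_or_ne n m with rfl | hn
    · rw [hP₂.mul_self, h1, ← mul_assoc, ← mul_assoc, hP₁.mul_self]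
    · rw [hP₂.mul_of_ne hn, ← mul_assoc, ← mul_assoc, hP₁.mul_of_ne hn, mul_zero, zero_mul,
        zero_mul]
  have hkPi : ∀ m, P₂ m * k⁻¹.1 = k⁻¹.1 * P₁ m := by
    intro m
    rw [Units.eq_inv_mul_iff_mul_eq, ← mul_assoc, hkP, mul_assoc, Units.mul_inv, mul_one]
  have hNk : q⁻¹.1 * N * q.1 = k⁻¹.1 * N * k.1 := by
    have h1 : g.1 * N * g⁻¹.1 = N := by rw [hgN, mul_assoc, Units.mul_inv, mul_one]
    simp only [k, mul_inv_rev, inv_inv, Units.val_mul]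
    calc q⁻¹.1 * N * q.1 = q⁻¹.1 * (g.1 * N * g⁻¹.1) * q.1 := by rw [h1]
      _ = _ := by simp only [mul_assoc]
  have hcN' : ∀ v m, P₂ (m + v) * (q⁻¹.1 * N * q.1) * P₂ m = k⁻¹.1 * c₁ v * k.1 * P₂ m := by
    intro v m
    calc P₂ (m + v) * (q⁻¹.1 * N * q.1) * P₂ m
        = (P₂ (m + v) * k⁻¹.1) * N * (k.1 * P₂ m) := by rw [hNk]; simp only [mul_assoc]
      _ = k⁻¹.1 * (P₁ (m + v) * N * P₁ m) * k.1 := by rw [hkP, hkPi]; simp only [mul_assoc]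
      _ = k⁻¹.1 * c₁ v * (P₁ m * k.1) := by rw [hP₁.weightDecomp_mul hc₁]; simp only [mul_assoc]
      _ = k⁻¹.1 * c₁ v * k.1 * P₂ m := by rw [← hkP]; simp only [mul_assoc]
  have hq_one : q.1 = 1 := by
    refine eq_one_of_primitive (N' := q⁻¹.1 * N * q.1) (c' := fun w => k⁻¹.1 * c₁ w * k.1)
      hW hs₂ hP₂ hcomm₂ hq1 hqP' ?_ hN ?_ (hP₂.weightDecomp_mul hc₂) hcN'
      (hP₂.adE_pow_weightDecomp_eq_zero hP'₂ hU'₂ hN hN₂ hD₂ hc₂) ?_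
      fun j f => hP₂.eq_zero_of_adE_pow_weightDecomp hP'₂ hU'₂ hN hN₂ h hD₂ hc₂ j
    · rw [← mul_assoc, ← mul_assoc, Units.mul_inv, one_mul]
    · exact mul_mem_endFilt (mul_mem_endFilt (inv_mem_endFilt q hq0) hN (add_zero 0)) hq0
        (add_zero 0)
    · intro j
      rw [adE_pow_conj, hP₁.adE_pow_weightDecomp_eq_zero hP'₁ hU'₁ hN hN₁ hD₁ hc₁, mul_zero,
        zero_mul]
  have hc : c₂ w = g.1 * c₁ w * g⁻¹.1 := by
    obtain rfl : q = 1 := Units.ext hq_one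
    refine hP₂.ext fun m => ?_
    have h1 := hcN' w m
    simp only [k, inv_one, Units.val_one, one_mul, mul_one, inv_inv] at h1
    rw [← h1, hP₂.weightDecomp_mul hc₂]
  have hc₁W' : c₁ w ∈ endFilt W' (-2) :=
    hP'₁.mem_endFilt hU'₁ (hP₁.weightDecomp_isHomogeneousEnd_snd hcomm₁ hN₁ hc₁ w)
  have hc₁W : c₁ w ∈ endFilt W w := hP₁.mem_endFilt hs₁ (hh₁ w)
  refine Submodule.mem_sup_left ⟨?_, ?_⟩
  · have h1 : c₁ w - c₂ w = (c₁ w * (g.1 - 1) - (g.1 - 1) * c₁ w) * g⁻¹.1 := by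
      rw [mul_sub, sub_mul (g : Module.End ℚ V), mul_one, one_mul, sub_sub_sub_cancel_right,
        sub_mul, hc, mul_assoc (c₁ w), Units.mul_inv, mul_one]
    rw [h1]
    exact mul_mem_endFilt (sub_mem (mul_mem_endFilt hc₁W' hgW' (by norm_num))
      (mul_mem_endFilt hgW' hc₁W' (by norm_num))) hgiW' (add_zero _)
  · rw [hc]
    exact sub_mem hc₁W (mul_mem_endFilt (mul_mem_endFilt hgW hc₁W (zero_add _)) hgiW (add_zero _))
end

section
/- Let V be a finite-dimensional vector space over ℚ, W a finite increasing filtration on V, N : V → V nilpotent with N(W_w) ⊆ W_w for all w, and let W' be the relative monodromy filtration of N with respect to W. Let (U'_w)⁽¹⁾ and (U'_w)⁽²⁾ be two splittings of W', each satisfying N(U'_w) ⊆ U'_{w−2} for all w and each compatible with W, and let g be the unique automorphism of V preserving W', inducing the identity on every gr^{W'}_w, and satisfying g((U'_w)⁽¹⁾) = (U'_w)⁽²⁾ for all w. Then g(W_w) = W_w for all w ∈ ℤ, and g∘N = N∘g. -/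
open Submodule

section Splitting

variable {V : Type*} [AddCommGroup V] [Module ℚ V]

lemma IsSplitting.le_iSup_ne {W U : ℤ → Submodule ℚ V} (h : IsSplitting W U) (n : ℤ) :
    W (n - 1) ≤ ⨆ k ≠ n, U k := by
  rw [h.2]
  exact iSup₂_le fun k hk => le_iSup₂_of_le k (by lia) le_rfl

lemma IsSplitting.le {W U : ℤ → Submodule ℚ V} (h : IsSplitting W U) (n : ℤ) : U n ≤ W n := by
  rw [h.2]
  exact le_iSup₂_of_le n le_rfl le_rfl

lemma IsSplitting.eq_zero_of_mem {W U : ℤ → Submodule ℚ V} (h : IsSplitting W U) {n : ℤ} {x : V}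
    (hx : x ∈ U n) (hx' : x ∈ ⨆ k ≠ n, U k) : x = 0 :=
  Submodule.disjoint_def.1 (h.1.submodule_iSupIndep n) x hx hx'

/-- If `S` is compatible with the splitting `U` and `x ∈ S`, then any `y ∈ U n` congruent to `x`
modulo `W (n - 1)` is the degree `n` component of `x`, hence lies in `S`. -/
lemma IsSplitting.mem_of_sub_mem {W U : ℤ → Submodule ℚ V} (h : IsSplitting W U)
    {S : Submodule ℚ V} (hS : S = ⨆ n : ℤ, S ⊓ U n) {n : ℤ} {x y : V} (hx : x ∈ S)
    (hy : y ∈ U n) (hxy : y - x ∈ W (n - 1)) : y ∈ S := by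
  rw [hS, iSup_split_single _ n] at hx
  obtain ⟨a, ha, b, hb, rfl⟩ := Submodule.mem_sup.1 hx
  have hb' : b ∈ ⨆ k ≠ n, U k :=
    (iSup₂_mono fun k _ => inf_le_right : ⨆ k ≠ n, S ⊓ U k ≤ ⨆ k ≠ n, U k) hb
  have hya : y - a = 0 := by
    refine h.eq_zero_of_mem (sub_mem hy ha.2) ?_
    convert add_mem (h.le_iSup_ne n hxy) hb' using 1
    abel
  rw [sub_eq_zero.1 hya]
  exact ha.1

end Splitting

/-- let `W'` be the relative monodromy filtration of `N` with respect to `W`,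
let `U'₁`, `U'₂` be two splittings of `W'` with `N(U'_w) ⊆ U'_{w-2}` and compatible with `W`,
and let `g` be the unique automorphism of `V` preserving `W'`, inducing the identity on
every `gr^{W'}_w`, and carrying `U'₁` to `U'₂`.  Then `g(W_w) = W_w` for all `w` and
`g ∘ N = N ∘ g`. -/
theorem automorphism_preserves_W_and_commutes_with_N
    {V : Type*} [AddCommGroup V] [Module ℚ V] [FiniteDimensional ℚ V]
    (W W' : ℤ → Submodule ℚ V) (hW : IsFiniteFiltration W)
    (N : Module.End ℚ V) (hNnil : IsNilpotent N)
    (hNW : ∀ w : ℤ, ∀ x ∈ W w, N x ∈ W w)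
    (h : IsRelMonFil N W W')
    (U'₁ U'₂ : ℤ → Submodule ℚ V)
    (hU'₁ : IsSplitting W' U'₁)
    (hNU'₁ : ∀ w : ℤ, ∀ x ∈ U'₁ w, N x ∈ U'₁ (w - 2))
    (hcompat₁ : ∀ w : ℤ, W w = ⨆ n : ℤ, W w ⊓ U'₁ n)
    (hU'₂ : IsSplitting W' U'₂)
    (hNU'₂ : ∀ w : ℤ, ∀ x ∈ U'₂ w, N x ∈ U'₂ (w - 2))
    (hcompat₂ : ∀ w : ℤ, W w = ⨆ n : ℤ, W w ⊓ U'₂ n)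
    (g : V ≃ₗ[ℚ] V)
    (hgW' : ∀ w : ℤ, Submodule.map (g : V →ₗ[ℚ] V) (W' w) = W' w)
    (hggr : ∀ w : ℤ, ∀ x ∈ W' w, g x - x ∈ W' (w - 1))
    (hgU : ∀ w : ℤ, Submodule.map (g : V →ₗ[ℚ] V) (U'₁ w) = U'₂ w) :
    (∀ w : ℤ, Submodule.map (g : V →ₗ[ℚ] V) (W w) = W w) ∧ ∀ x : V, g (N x) = N (g x) := by
  constructor
  · intro w
    refine Submodule.eq_of_le_of_finrank_eq ?_ (LinearEquiv.finrank_map_eq g (W w))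
    conv_lhs => rw [hcompat₁ w]
    rw [Submodule.map_iSup]
    refine iSup_le fun n => ?_
    rintro _ ⟨x, ⟨hxW, hxU⟩, rfl⟩
    exact hU'₂.mem_of_sub_mem (hcompat₂ w) hxW (hgU n ▸ Submodule.mem_map_of_mem hxU)
      (hggr n x (hU'₁.le n hxU))
  · intro x
    have hx : x ∈ ⨆ n, U'₁ n := hU'₁.1.submodule_iSup_eq_top ▸ Submodule.mem_top
    induction hx using Submodule.iSup_induction' with
    | mem n x hx =>
      have hgx : g x ∈ U'₂ n := hgU n ▸ Submodule.mem_map_of_mem hx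
      have hgNx : g (N x) ∈ U'₂ (n - 2) := hgU (n - 2) ▸ Submodule.mem_map_of_mem (hNU'₁ n x hx)
      have h₁ : g (N x) - N x ∈ W' (n - 2 - 1) := hggr _ _ (hU'₁.le _ (hNU'₁ n x hx))
      have h₂ : N (g x - x) ∈ W' (n - 2 - 1) := by
        rw [sub_right_comm]
        exact h.2.1 _ _ (hggr n x (hU'₁.le n hx))
      refine sub_eq_zero.1 (hU'₂.eq_zero_of_mem (sub_mem hgNx (hNU'₂ n _ hgx))
        (hU'₂.le_iSup_ne _ ?_))
      convert sub_mem h₁ h₂ using 1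
      rw [map_sub]
      abel
    | zero => simp
    | add x y _ _ hx hy => simp only [map_add, hx, hy]
end

section
/- Let V be a finite-dimensional vector space over ℚ, W a finite increasing filtration on V, N : V → V nilpotent with N(W_w) ⊆ W_w for all w, and let W' be the relative monodromy filtration of N with respect to W. Let (U'_w)⁽¹⁾ and (U'_w)⁽²⁾ be two splittings of W', each satisfying N(U'_w) ⊆ U'_{w−2} for all w and each compatible with W, and let g be the unique automorphism of V preserving W', inducing the identity on every gr^{W'}_w, and satisfying g((U'_w)⁽¹⁾) = (U'_w)⁽²⁾ for all w. If (U_w)⁽¹⁾ is the Deligne splitting of W associated to (U'_w)⁽¹⁾ and (U_w)⁽²⁾ is the Deligne splitting of W associated to (U'_w)⁽²⁾, then (U_w)⁽²⁾ = g((U_w)⁽¹⁾) for all w ∈ ℤ. -/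
open Submodule

namespace DeligneSplitting

section Grading

variable {ι V : Type*} [DecidableEq ι] [AddCommGroup V] [Module ℚ V] {U : ι → Submodule ℚ V}

/-- The endomorphism which agrees with `F i` on the `i`-th piece of a grading. -/
noncomputable def glue (hU : DirectSum.IsInternal U) (F : ι → Module.End ℚ V) :
    Module.End ℚ V :=
  (DirectSum.toModule ℚ ι V fun i => (F i).domRestrict (U i)) ∘ₗ
    (LinearEquiv.ofBijective (DirectSum.coeLinearMap U) hU).symm.toLinearMap

lemma glue_apply (hU : DirectSum.IsInternal U) (F : ι → Module.End ℚ V) {i : ι} {x : V}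
    (hx : x ∈ U i) : glue hU F x = F i x := by
  have : (LinearEquiv.ofBijective (DirectSum.coeLinearMap U) hU).symm x =
      DirectSum.lof ℚ ι (fun i => U i) i ⟨x, hx⟩ := by
    rw [LinearEquiv.symm_apply_eq]
    exact (DirectSum.coeLinearMap_lof (A := U) i ⟨x, hx⟩).symm
  simp [glue, this]

lemma grading_induction (hU : DirectSum.IsInternal U) {p : V → Prop} (x : V)
    (mem : ∀ i, ∀ x ∈ U i, p x) (zero : p 0) (h_add : ∀ x y, p x → p y → p (x + y)) : p x :=
  Submodule.iSup_induction U (motive := p) (hU.submodule_iSup_eq_top ▸ Submodule.mem_top)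
    mem zero h_add

lemma grading_ext (hU : DirectSum.IsInternal U) {M : Type*} [AddCommGroup M] [Module ℚ M]
    {f g : V →ₗ[ℚ] M} (h : ∀ i, ∀ x ∈ U i, f x = g x) : f = g := by
  ext x
  refine grading_induction hU (p := fun x => f x = g x) x h (by simp)
    fun x y hx hy => by simp [hx, hy]

/-- The projection onto the `i`-th piece of a grading. -/
noncomputable def proj (hU : DirectSum.IsInternal U) (i : ι) : Module.End ℚ V :=
  glue hU fun j => if j = i then 1 else 0

lemma proj_same (hU : DirectSum.IsInternal U) {i : ι} {x : V} (hx : x ∈ U i) :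
    proj hU i x = x := by
  simp [proj, glue_apply hU _ hx]

lemma proj_ne (hU : DirectSum.IsInternal U) {i j : ι} {x : V} (hx : x ∈ U j) (h : j ≠ i) :
    proj hU i x = 0 := by
  simp [proj, glue_apply hU _ hx, h]

lemma proj_mem (hU : DirectSum.IsInternal U) (i : ι) (x : V) : proj hU i x ∈ U i := by
  refine grading_induction hU (p := fun x => proj hU i x ∈ U i) x (fun j y hy => ?_) (by simp)
    fun x y hx hy => by simpa using add_mem hx hy
  by_cases h : j = i
  · subst h
    rwa [proj_same hU hy]
  · simp [proj_ne hU hy h]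

lemma mem_iff_proj (hU : DirectSum.IsInternal U) {i : ι} {x : V} :
    x ∈ U i ↔ proj hU i x = x :=
  ⟨proj_same hU, fun h => h ▸ proj_mem hU i x⟩

lemma sum_proj (hU : DirectSum.IsInternal U) (s : Finset ι) (hs : ∀ i, i ∉ s → U i = ⊥) :
    ∑ i ∈ s, proj hU i = 1 := by
  refine grading_ext hU fun j x hx => ?_
  rw [LinearMap.sum_apply]
  by_cases hj : j ∈ s
  · rw [Finset.sum_eq_single_of_mem j hj fun i _ hi => proj_ne hU hx hi.symm]
    simpa using proj_same hU hx
  · have : x = 0 := by simpa [hs j hj] using hx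
    simp [this]

lemma exists_finset_support [FiniteDimensional ℚ V] (hU : DirectSum.IsInternal U) :
    ∃ s : Finset ι, ∀ i, i ∉ s → U i = ⊥ := by
  have := WellFoundedGT.finite_ne_bot_of_iSupIndep hU.submodule_iSupIndep
  exact ⟨this.toFinset, fun i hi => by simpa using hi⟩

lemma eq_zero_of_proj [FiniteDimensional ℚ V] (hU : DirectSum.IsInternal U) {x : V}
    (h : ∀ i, proj hU i x = 0) : x = 0 := by
  obtain ⟨s, hs⟩ := exists_finset_support hU
  have := congr($(sum_proj hU s hs) x)
  simpa [h] using this.symm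

/-- Two gradings, one of which is contained in the other, are equal. -/
lemma grading_eq_of_le {U' : ι → Submodule ℚ V} (hU : DirectSum.IsInternal U)
    (hU' : DirectSum.IsInternal U') (h : ∀ i, U i ≤ U' i) (i : ι) : U i = U' i := by
  refine le_antisymm (h i) fun x hx => ?_
  have : proj hU i = proj hU' i := by
    refine grading_ext hU fun j y hy => ?_
    by_cases hj : j = i
    · subst hj
      rw [proj_same hU hy, proj_same hU' (h _ hy)]
    · rw [proj_ne hU hy hj, proj_ne hU' (h _ hy) hj]
  rw [mem_iff_proj hU, this, proj_same hU' hx]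

lemma isInternal_comap (hU : DirectSum.IsInternal U) (e : V ≃ₗ[ℚ] V) :
    DirectSum.IsInternal fun i => (U i).comap (e : V →ₗ[ℚ] V) := by
  have h : (fun i => (U i).comap (e : V →ₗ[ℚ] V)) =
      (Submodule.orderIsoMapComap e).symm ∘ U := rfl
  rw [h, DirectSum.isInternal_submodule_iff_iSupIndep_and_iSup_eq_top]
  refine ⟨(iSupIndep_map_orderIso_iff _).mpr hU.submodule_iSupIndep, ?_⟩
  have := congr((Submodule.orderIsoMapComap e).symm $(hU.submodule_iSup_eq_top))
  rwa [OrderIso.map_iSup, OrderIso.map_top] at this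

end Grading

section BoundedGrading

variable {V : Type*} [AddCommGroup V] [Module ℚ V] [FiniteDimensional ℚ V]
  {U : ℤ → Submodule ℚ V}

lemma exists_bound (hU : DirectSum.IsInternal U) :
    ∃ b : ℕ, ∀ i : ℤ, (i < -b ∨ b < i) → U i = ⊥ := by
  obtain ⟨s, hs⟩ := exists_finset_support hU
  refine ⟨∑ i ∈ s, i.natAbs, fun i hi => hs i fun his => ?_⟩
  have := Finset.single_le_sum (f := Int.natAbs) (fun _ _ => Nat.zero_le _) his
  omega

end BoundedGrading

lemma adE_apply {V : Type*} [AddCommGroup V] [Module ℚ V] (N f : Module.End ℚ V) :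
    adE N f = N * f - f * N := by
  simp [adE]

section Trace

variable {V : Type*} [AddCommGroup V] [Module ℚ V] [FiniteDimensional ℚ V]

lemma eq_zero_of_trace_mul_eq_zero {f : Module.End ℚ V}
    (h : ∀ g : Module.End ℚ V, LinearMap.trace ℚ V (f * g) = 0) : f = 0 := by
  ext v
  refine (Module.forall_dual_apply_eq_zero_iff ℚ (f v)).mp fun φ => ?_
  have h1 := h (φ.smulRight v)
  have h2 : f * φ.smulRight v = dualTensorHom ℚ V V (φ ⊗ₜ[ℚ] f v) := by
    ext x
    simp
  rw [h2, LinearMap.trace_eq_contract_apply] at h1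
  simpa using h1

lemma exists_trace_mul (φ : Module.Dual ℚ (Module.End ℚ V)) :
    ∃ f : Module.End ℚ V, ∀ g, φ g = LinearMap.trace ℚ V (f * g) := by
  let B : Module.End ℚ V →ₗ[ℚ] Module.Dual ℚ (Module.End ℚ V) :=
    (LinearMap.mul ℚ (Module.End ℚ V)).compr₂ (LinearMap.trace ℚ V)
  have hB : Function.Injective B := by
    rw [injective_iff_map_eq_zero]
    exact fun f hf => eq_zero_of_trace_mul_eq_zero fun g => congr($hf g)
  obtain ⟨f, hf⟩ := (LinearMap.injective_iff_surjective_of_finrank_eq_finrank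
    Subspace.dual_finrank_eq.symm).mp hB φ
  exact ⟨f, fun g => congr($hf.symm g)⟩

/-- An endomorphism which is orthogonal, for the trace form, to the commutant of `N` is a
commutator with `N`. -/
lemma exists_adE_eq (N H : Module.End ℚ V)
    (h : ∀ f : Module.End ℚ V, f * N = N * f → LinearMap.trace ℚ V (f * H) = 0) :
    ∃ E : Module.End ℚ V, E * N - N * E = H := by
  by_contra! hne
  have hH : H ∉ LinearMap.range (adE N) := by
    rintro ⟨E, hE⟩
    refine hne (-E) ?_
    rw [← hE, adE_apply]
    noncomm_ring
  obtain ⟨φ, hφH, hφ⟩ := Submodule.exists_dual_map_eq_bot_of_notMem hH inferInstance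
  obtain ⟨f, hf⟩ := exists_trace_mul φ
  refine hφH ?_
  rw [hf]
  refine h f (sub_eq_zero.mp (eq_zero_of_trace_mul_eq_zero fun g => ?_))
  have h0 : φ (adE N g) = 0 := by
    rw [← Submodule.mem_bot ℚ, ← hφ]
    exact Submodule.mem_map_of_mem ⟨g, rfl⟩
  rw [hf, adE_apply, mul_sub, map_sub] at h0
  rw [sub_mul, map_sub, mul_assoc, ← h0, ← mul_assoc f g N,
    LinearMap.trace_mul_comm ℚ (f * g) N, mul_assoc N f g]

end Trace

section SlTwo

variable {M : Type*} [AddCommGroup M] [Module ℚ M] {e y h : Module.End ℚ M}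

lemma weight_pow (hy : h * y - y * h = (-2 : ℚ) • y) {v : M} {k : ℚ} (hv : h v = k • v) (i : ℕ) :
    h ((y ^ i) v) = (k - 2 * i) • (y ^ i) v := by
  induction i with
  | zero => simp [hv]
  | succ i ih =>
    have := congr($hy ((y ^ i) v))
    simp only [LinearMap.sub_apply, Module.End.mul_apply, LinearMap.smul_apply, ih,
      map_smul] at this
    rw [pow_succ', Module.End.mul_apply, sub_eq_iff_eq_add.mp this]
    push_cast
    module

lemma raise_pow (he : e * y - y * e = h) (hy : h * y - y * h = (-2 : ℚ) • y) {v : M} {k : ℚ}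
    (hv : h v = k • v) (i : ℕ) :
    e ((y ^ (i + 1)) v) = (y ^ (i + 1)) (e v) + ((i + 1) * (k - i)) • (y ^ i) v := by
  induction i with
  | zero =>
    have := congr($he v)
    simp only [LinearMap.sub_apply, Module.End.mul_apply, hv] at this
    simp [sub_eq_iff_eq_add'.mp this]
  | succ i ih =>
    have := congr($he ((y ^ (i + 1)) v))
    simp only [LinearMap.sub_apply, Module.End.mul_apply, weight_pow hy hv] at this
    rw [pow_succ' y (i + 1), Module.End.mul_apply, sub_eq_iff_eq_add'.mp this, ih, map_add,
      map_smul, ← Module.End.mul_apply y, ← Module.End.mul_apply y, ← pow_succ', ← pow_succ']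
    push_cast
    module

/-- In a module over `sl₂` on which `e` acts nilpotently, `y ^ k` is injective on the weight space
of weight `k`. -/
lemma eq_zero_of_lower_pow (he : e * y - y * e = h) (hy : h * y - y * h = (-2 : ℚ) • y)
    (hhe : h * e - e * h = (2 : ℚ) • e) (d : ℕ) :
    ∀ (k : ℕ) (v : M), h v = (k : ℚ) • v → (y ^ k) v = 0 → (e ^ d) v = 0 → v = 0 := by
  induction d with
  | zero => exact fun k v _ _ h0 => by simpa using h0
  | succ d ih =>
    intro k v hv hyv hev
    have hev0 : e v = 0 := by
      refine ih (k + 2) (e v) ?_ ?_ (by rwa [pow_succ, Module.End.mul_apply] at hev)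
      · have := congr($hhe v)
        simp only [LinearMap.sub_apply, Module.End.mul_apply, LinearMap.smul_apply, hv,
          map_smul] at this
        rw [sub_eq_iff_eq_add.mp this]
        push_cast
        module
      · have h1 := raise_pow he hy hv (k + 1)
        have h2 : (y ^ (k + 1)) v = 0 := by rw [pow_succ', Module.End.mul_apply, hyv, map_zero]
        have h3 : (y ^ (k + 1 + 1)) v = 0 := by
          rw [pow_succ', Module.End.mul_apply, h2, map_zero]
        rw [h2, h3] at h1
        simpa using h1.symm
    have key : ∀ i, i ≤ k → (y ^ (k - i)) v = 0 := by
      intro i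
      induction i with
      | zero => exact fun _ => hyv
      | succ i ihi =>
        intro hi
        have h1 := raise_pow he hy hv (k - (i + 1))
        rw [show k - (i + 1) + 1 = k - i by omega, ihi (by omega), hev0] at h1
        simp only [map_zero, zero_add] at h1
        refine (smul_eq_zero.mp h1.symm).resolve_left ?_
        rw [Nat.cast_sub hi]
        push_cast
        have : (i : ℚ) + 1 ≤ k := by exact_mod_cast hi
        have h5 : (0 : ℚ) ≤ i := by positivity
        refine mul_ne_zero (by linarith) (by linarith)
    simpa using key k le_rfl

end SlTwo

section Shift

variable {V : Type*} [AddCommGroup V] [Module ℚ V] {U : ℤ → Submodule ℚ V}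

lemma proj_shift (hU : DirectSum.IsInternal U) {f : Module.End ℚ V} {w : ℤ}
    (hf : ∀ j, ∀ x ∈ U j, f x ∈ U (j + w)) {i j : ℤ} (hij : i = j + w) :
    proj hU i * f = f * proj hU j := by
  subst hij
  refine grading_ext hU fun m x hx => ?_
  simp only [Module.End.mul_apply]
  by_cases h : m = j
  · subst h
    rw [proj_same hU (hf _ _ hx), proj_same hU hx]
  · rw [proj_ne hU (hf _ _ hx) (by omega), proj_ne hU hx h, map_zero]

lemma shift_pow {f : Module.End ℚ V} {w : ℤ} (hf : ∀ j, ∀ x ∈ U j, f x ∈ U (j + w)) (n : ℕ) :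
    ∀ j, ∀ x ∈ U j, (f ^ n) x ∈ U (j + n * w) := by
  induction n with
  | zero => simp
  | succ n ih =>
    intro j x hx
    rw [pow_succ', Module.End.mul_apply]
    convert hf _ _ (ih j x hx) using 2
    push_cast
    ring

/-- The weight `w` component of an endomorphism of a graded space. -/
noncomputable def comp (hU : DirectSum.IsInternal U) (w : ℤ) (f : Module.End ℚ V) :
    Module.End ℚ V :=
  glue hU fun m => proj hU (m + w) * f

lemma comp_apply (hU : DirectSum.IsInternal U) (w : ℤ) (f : Module.End ℚ V) {m : ℤ} {x : V}
    (hx : x ∈ U m) : comp hU w f x = proj hU (m + w) (f x) :=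
  glue_apply hU _ hx

lemma comp_mem (hU : DirectSum.IsInternal U) (w : ℤ) (f : Module.End ℚ V) {m : ℤ} {x : V}
    (hx : x ∈ U m) : comp hU w f x ∈ U (m + w) :=
  comp_apply hU w f hx ▸ proj_mem hU _ _

lemma comp_sub (hU : DirectSum.IsInternal U) (w : ℤ) (f g : Module.End ℚ V) :
    comp hU w (f - g) = comp hU w f - comp hU w g := by
  refine grading_ext hU fun m x hx => ?_
  simp [comp_apply hU w _ hx]

lemma comp_zero_one (hU : DirectSum.IsInternal U) : comp hU 0 (1 : Module.End ℚ V) = 1 := by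
  refine grading_ext hU fun m x hx => ?_
  rw [comp_apply hU 0 _ hx, add_zero]
  exact proj_same hU hx

end Shift

section Lefschetz

variable {V : Type*} [AddCommGroup V] [Module ℚ V] [FiniteDimensional ℚ V]
  {T : ℤ → Submodule ℚ V} {N : Module.End ℚ V}

lemma trace_mul_proj_neg (hT : DirectSum.IsInternal T)
    (hN : ∀ j, ∀ x ∈ T j, N x ∈ T (j + -2)) (n : ℕ)
    (hinj : ∀ x ∈ T n, (N ^ n) x = 0 → x = 0)
    (hsurj : ∀ y ∈ T (-n), ∃ x ∈ T n, (N ^ n) x = y)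
    {f : Module.End ℚ V} (hf : f * N = N * f) :
    LinearMap.trace ℚ V (f * proj hT n) = LinearMap.trace ℚ V (f * proj hT (-n)) := by
  set P : Module.End ℚ V := proj hT n with hP
  set Q : Module.End ℚ V := proj hT (-n) with hQ
  have hQN : Q * N ^ n = N ^ n * P := proj_shift hT (shift_pow hN n) (by ring)
  have hQQ : Q * Q = Q := LinearMap.ext fun x => proj_same hT (proj_mem hT _ x)
  have hrange : ∀ x, Q x ∈ LinearMap.range (N ^ n * P) := by
    intro x
    obtain ⟨z, hz, hzx⟩ := hsurj (Q x) (proj_mem hT _ x)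
    exact ⟨z, by rw [Module.End.mul_apply, hP, proj_same hT hz, hzx]⟩
  obtain ⟨G, hG⟩ := Module.projective_lifting_property (N ^ n * P).rangeRestrict
    (Q.codRestrict _ hrange) (N ^ n * P).surjective_rangeRestrict
  have hG : N ^ n * P * G = Q := LinearMap.ext fun x => congr(($hG x : V))
  have hGP : P * G * (N ^ n * P) = P := by
    refine LinearMap.ext fun x => sub_eq_zero.mp (hinj _ ?_ ?_)
    · exact sub_mem (proj_mem hT _ _) (proj_mem hT _ _)
    · have h1 : N ^ n * (P * G * (N ^ n * P)) = N ^ n * P := by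
        rw [← mul_assoc (N ^ n) (P * G), ← mul_assoc (N ^ n) P, hG, ← hQN, ← mul_assoc, hQQ]
      have := congr($h1 x)
      rw [map_sub, sub_eq_zero]
      exact this
  have hcomm : N ^ n * f = f * N ^ n := ((show Commute f N from hf).pow_right n).symm
  calc LinearMap.trace ℚ V (f * P)
      = LinearMap.trace ℚ V (f * (P * G) * (N ^ n * P)) := by rw [mul_assoc f, hGP]
    _ = LinearMap.trace ℚ V (N ^ n * P * (f * (P * G))) := LinearMap.trace_mul_comm _ _ _
    _ = LinearMap.trace ℚ V (Q * (f * Q)) := by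
      congr 1
      rw [← hQN, mul_assoc Q, ← mul_assoc (N ^ n) f, hcomm, mul_assoc f, ← mul_assoc (N ^ n), hG]
    _ = LinearMap.trace ℚ V (f * Q) := by rw [LinearMap.trace_mul_comm, mul_assoc, hQQ]

/-- If `N` lowers the degree by two and `N ^ n` is an isomorphism from degree `n` to degree `-n`
for all `n`, then `N` is part of an `sl₂`-triple for which the grading is the weight grading. -/
lemma exists_sl_two (hT : DirectSum.IsInternal T)
    (hN : ∀ j, ∀ x ∈ T j, N x ∈ T (j + -2))
    (hinj : ∀ n : ℕ, ∀ x ∈ T n, (N ^ n) x = 0 → x = 0)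
    (hsurj : ∀ n : ℕ, ∀ y ∈ T (-n), ∃ x ∈ T n, (N ^ n) x = y) :
    ∃ E H : Module.End ℚ V, (∀ j, ∀ x ∈ T j, H x = (j : ℚ) • x) ∧
      (∀ j, ∀ x ∈ T j, E x ∈ T (j + 2)) ∧ E * N - N * E = H := by
  let H : Module.End ℚ V := glue hT fun j => (j : ℚ) • 1
  have hH : ∀ j, ∀ x ∈ T j, H x = (j : ℚ) • x := fun j x hx => by
    simp [H, glue_apply hT _ hx]
  obtain ⟨b, hb⟩ := exists_bound hT
  have hsum : H = ∑ j ∈ Finset.Icc (-b : ℤ) b, (j : ℚ) • proj hT j := by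
    have h1 := sum_proj hT (Finset.Icc (-b : ℤ) b) fun i hi => hb i (by simp at hi; omega)
    have h2 : ∀ j, H * proj hT j = (j : ℚ) • proj hT j := fun j =>
      LinearMap.ext fun x => hH j _ (proj_mem hT j x)
    rw [← mul_one H, ← h1, Finset.mul_sum]
    exact Finset.sum_congr rfl fun j _ => h2 j
  obtain ⟨E, hE⟩ := exists_adE_eq N H fun f hf => by
    have heven : ∀ j : ℤ, LinearMap.trace ℚ V (f * proj hT (-j)) =
        LinearMap.trace ℚ V (f * proj hT j) := by
      intro j
      obtain ⟨n, rfl | rfl⟩ := j.eq_nat_or_neg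
      · exact (trace_mul_proj_neg hT hN n (hinj n) (hsurj n) hf).symm
      · rw [neg_neg]
        exact trace_mul_proj_neg hT hN n (hinj n) (hsurj n) hf
    rw [hsum, Finset.mul_sum, map_sum]
    have key : ∑ j ∈ Finset.Icc (-b : ℤ) b, LinearMap.trace ℚ V (f * (j : ℚ) • proj hT j) =
        ∑ j ∈ Finset.Icc (-b : ℤ) b, -LinearMap.trace ℚ V (f * (j : ℚ) • proj hT j) := by
      refine Finset.sum_nbij' (fun j => -j) (fun j => -j) ?_ ?_ (by simp) (by simp) ?_
      · intro j hj
        simp at hj ⊢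
        omega
      · intro j hj
        simp at hj ⊢
        omega
      · intro j _
        simp [heven]
    rw [Finset.sum_neg_distrib] at key
    linarith
  refine ⟨comp hT 2 E, H, hH, fun j x hx => comp_mem hT 2 E hx, ?_⟩
  refine grading_ext hT fun j x hx => ?_
  have h1 := congr(proj hT j ($hE x))
  rw [hH j x hx, map_smul, proj_same hT hx] at h1
  have h2 : proj hT j (N (E x)) = N (proj hT (j + 2) (E x)) :=
    congr($(proj_shift hT hN (i := j) (j := j + 2) (by ring)) (E x))
  simp only [LinearMap.sub_apply, Module.End.mul_apply, map_sub] at h1 ⊢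
  rw [comp_apply hT 2 E hx, comp_apply hT 2 E (hN j x hx), hH j x hx, ← h1, h2]
  ring_nf

/-- The Lefschetz property is inherited by `End(V)`, with `Ad(N)` in place of `N`. -/
lemma eq_zero_of_adE_pow_eq_zero (hT : DirectSum.IsInternal T)
    (hN : ∀ j, ∀ x ∈ T j, N x ∈ T (j + -2))
    (hinj : ∀ n : ℕ, ∀ x ∈ T n, (N ^ n) x = 0 → x = 0)
    (hsurj : ∀ n : ℕ, ∀ y ∈ T (-n), ∃ x ∈ T n, (N ^ n) x = y)
    {k : ℕ} {f : Module.End ℚ V} (hf : ∀ j, ∀ x ∈ T j, f x ∈ T (j + k))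
    (h : ((adE N) ^ k) f = 0) : f = 0 := by
  obtain ⟨E, H, hH, hE, hEN⟩ := exists_sl_two hT hN hinj hsurj
  have hweight : ∀ (g : Module.End ℚ V) (w : ℤ), (∀ j, ∀ x ∈ T j, g x ∈ T (j + w)) →
      H * g - g * H = (w : ℚ) • g := by
    intro g w hg
    refine grading_ext hT fun j x hx => ?_
    simp only [LinearMap.sub_apply, Module.End.mul_apply, LinearMap.smul_apply, hH j x hx,
      hH _ _ (hg j x hx), map_smul]
    push_cast
    module
  have had : ∀ A B C : Module.End ℚ V, A * B - B * A = C →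
      adE A * adE B - adE B * adE A = adE C := by
    rintro A B C rfl
    ext1 g
    simp only [LinearMap.sub_apply, Module.End.mul_apply, adE_apply]
    noncomm_ring
  have hsmul : ∀ (c : ℚ) (A : Module.End ℚ V), adE (c • A) = c • adE A := by
    intro c A
    ext1 g
    simp [adE_apply, smul_sub]
  have hnil : IsNilpotent E := by
    obtain ⟨b, hb⟩ := exists_bound hT
    refine ⟨b + 1, grading_ext hT fun j x hx => ?_⟩
    rcases lt_or_ge j (-b) with hj | hj
    · have : x = 0 := by simpa [hb j (Or.inl hj)] using hx
      simp [this]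
    · have := shift_pow hE (b + 1) j x hx
      rw [hb _ (Or.inr (by push_cast; omega))] at this
      simpa using this
  obtain ⟨d, hd⟩ : IsNilpotent (adE E) := by
    refine Commute.isNilpotent_sub (LinearMap.commute_mulLeft_right E E) ?_ ?_
    · exact (LinearMap.isNilpotent_mulLeft_iff ℚ E).mpr hnil
    · exact (LinearMap.isNilpotent_mulRight_iff ℚ E).mpr hnil
  refine eq_zero_of_lower_pow (had E N H hEN) ?_ ?_ d k f ?_ h (by simp [hd])
  · rw [had H N _ (hweight N _ hN), hsmul]
    norm_num
  · rw [had H E _ (hweight E _ hE), hsmul]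
    norm_num
  · rw [adE_apply]
    exact_mod_cast hweight f k hf

end Lefschetz

section Filtration

variable {V : Type*} [AddCommGroup V] [Module ℚ V] {W U : ℤ → Submodule ℚ V}

lemma splitting_le (hS : IsSplitting W U) {n w : ℤ} (h : n ≤ w) : U n ≤ W w := by
  rw [hS.2 w]
  exact le_iSup₂_of_le n h le_rfl

lemma filtration_le (hS : IsSplitting W U) {w : ℤ} {S : Submodule ℚ V}
    (h : ∀ n ≤ w, U n ≤ S) : W w ≤ S := by
  rw [hS.2 w]
  exact iSup₂_le h

lemma splitting_mono (hS : IsSplitting W U) : Monotone W := fun _ _ h =>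
  filtration_le hS fun _ hn => splitting_le hS (hn.trans h)

lemma proj_eq_zero_of_lt (hS : IsSplitting W U) {w i : ℤ} (h : w < i) {x : V} (hx : x ∈ W w) :
    proj hS.1 i x = 0 :=
  (filtration_le hS (S := LinearMap.ker (proj hS.1 i)) fun n hn _ hy =>
    proj_ne hS.1 hy (by omega)) hx

lemma sub_proj_mem (hS : IsSplitting W U) {w : ℤ} {x : V} (hx : x ∈ W w) :
    x - proj hS.1 w x ∈ W (w - 1) := by
  refine (filtration_le hS (S := (W (w - 1)).comap (1 - proj hS.1 w)) fun n hn y hy => ?_) hx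
  simp only [Submodule.mem_comap, LinearMap.sub_apply, Module.End.one_apply]
  by_cases h : n = w
  · subst h
    simp [proj_same hS.1 hy]
  · rw [proj_ne hS.1 hy h, sub_zero]
    exact splitting_le hS (by omega) hy

lemma mem_endFilt_of_splitting (hS : IsSplitting W U) {k : ℤ} {f : Module.End ℚ V}
    (h : ∀ m, ∀ x ∈ U m, f x ∈ W (m + k)) : f ∈ endFilt W k := fun w x hx =>
  (filtration_le hS (S := (W (w + k)).comap f) fun n hn y hy =>
    splitting_mono hS (by omega) (h n y hy)) hx

lemma endFilt_mono (hW : Monotone W) {k l : ℤ} (h : k ≤ l) : endFilt W k ≤ endFilt W l :=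
  fun _ hf w x hx => hW (by omega) (hf w x hx)

lemma mul_mem_endFilt {k l : ℤ} {f g : Module.End ℚ V} (hf : f ∈ endFilt W k)
    (hg : g ∈ endFilt W l) : f * g ∈ endFilt W (k + l) := fun w x hx => by
  rw [add_comm k l, ← add_assoc]
  exact hf _ _ (hg w x hx)

lemma mul_mem_endFilt_of_eq {k l m : ℤ} {f g : Module.End ℚ V} (hf : f ∈ endFilt W k)
    (hg : g ∈ endFilt W l) (h : k + l = m) : f * g ∈ endFilt W m :=
  h ▸ mul_mem_endFilt hf hg

lemma pow_mem_endFilt {k : ℤ} {f : Module.End ℚ V} (hf : f ∈ endFilt W k) (n : ℕ) :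
    f ^ n ∈ endFilt W (n * k) := by
  induction n with
  | zero => exact fun w x hx => by simpa using hx
  | succ n ih => exact pow_succ f n ▸ mul_mem_endFilt_of_eq ih hf (by push_cast; ring)

lemma endFilt_eq_zero (hW : IsFiniteFiltration W) :
    ∃ d : ℕ, ∀ f ∈ endFilt W (-d), f = 0 := by
  obtain ⟨-, ⟨a, ha⟩, b, hb⟩ := hW
  refine ⟨(b - a).toNat, fun f hf => LinearMap.ext fun x => ?_⟩
  have := hf b x (by simp [hb b le_rfl])
  rw [ha _ (by omega)] at this
  simpa using this

variable (hS : IsSplitting W U)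

lemma comp_mem_endFilt (w : ℤ) (f : Module.End ℚ V) : comp hS.1 w f ∈ endFilt W w :=
  mem_endFilt_of_splitting hS fun _ _ hx => splitting_le hS le_rfl (comp_mem hS.1 w f hx)

lemma sub_comp_mem_endFilt {w : ℤ} {f : Module.End ℚ V} (hf : f ∈ endFilt W w) :
    f - comp hS.1 w f ∈ endFilt W (w - 1) := by
  refine mem_endFilt_of_splitting hS fun m x hx => ?_
  rw [LinearMap.sub_apply, comp_apply hS.1 w f hx, ← add_sub_assoc]
  exact sub_proj_mem hS (hf m x (splitting_le hS le_rfl hx))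

lemma comp_eq_zero {v w : ℤ} (h : v < w) {f : Module.End ℚ V} (hf : f ∈ endFilt W v) :
    comp hS.1 w f = 0 := by
  refine grading_ext hS.1 fun m x hx => ?_
  rw [comp_apply hS.1 w f hx]
  exact proj_eq_zero_of_lt hS (by omega) (hf m x (splitting_le hS le_rfl hx))

/-- Taking leading components is multiplicative. -/
lemma comp_mul {u v w : ℤ} {f g : Module.End ℚ V} (hf : f ∈ endFilt W v)
    (hg : g ∈ endFilt W w) (h : v + w = u) :
    comp hS.1 u (f * g) = comp hS.1 v f * comp hS.1 w g := by
  subst h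
  refine grading_ext hS.1 fun m x hx => ?_
  have h1 := hf _ _ (sub_proj_mem hS (hg m x (splitting_le hS le_rfl hx)))
  have h2 := proj_eq_zero_of_lt hS (i := m + (v + w)) (by omega) h1
  rw [map_sub, map_sub, sub_eq_zero] at h2
  rw [comp_apply hS.1 _ _ hx, Module.End.mul_apply, Module.End.mul_apply,
    comp_apply hS.1 v f (comp_mem hS.1 w g hx), comp_apply hS.1 w g hx, h2]
  ring_nf

/-- `Ad(N)` and `Ad(N₀)`, for `N₀` the weight zero component of `N`, agree on leading
components. -/
lemma adE_pow_sub_mem {N : Module.End ℚ V} (hN : N ∈ endFilt W 0) {w : ℤ}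
    {f : Module.End ℚ V} (hf : f ∈ endFilt W w) (k : ℕ) :
    ((adE N) ^ k) f - ((adE (comp hS.1 0 N)) ^ k) f ∈ endFilt W (w - 1) ∧
      ((adE (comp hS.1 0 N)) ^ k) f ∈ endFilt W w := by
  induction k with
  | zero => exact ⟨by simp, by simpa using hf⟩
  | succ k ih =>
    obtain ⟨h1, h2⟩ := ih
    have h3 := sub_comp_mem_endFilt hS hN
    have h4 := comp_mem_endFilt hS 0 N
    simp only [pow_succ', Module.End.mul_apply]
    set a := ((adE N) ^ k) f
    set b := ((adE (comp hS.1 0 N)) ^ k) f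
    set N₀ := comp hS.1 0 N
    have key : adE N a - adE N₀ b =
        (N * (a - b) - (a - b) * N) + ((N - N₀) * b - b * (N - N₀)) := by
      simp only [adE_apply]
      noncomm_ring
    constructor
    · rw [key]
      refine add_mem (sub_mem ?_ ?_) (sub_mem ?_ ?_)
      · exact mul_mem_endFilt_of_eq hN h1 (by ring)
      · exact mul_mem_endFilt_of_eq h1 hN (by ring)
      · exact mul_mem_endFilt_of_eq h3 h2 (by ring)
      · exact mul_mem_endFilt_of_eq h2 h3 (by ring)
    · rw [adE_apply]
      exact sub_mem (mul_mem_endFilt_of_eq h4 h2 (by ring)) (mul_mem_endFilt_of_eq h2 h4 (by ring))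

lemma pow_sub_comp_pow_mem {N : Module.End ℚ V} (hN : N ∈ endFilt W 0) (k : ℕ) :
    N ^ k - comp hS.1 0 N ^ k ∈ endFilt W (-1) := by
  induction k with
  | zero => simp
  | succ k ih =>
    have h0 : comp hS.1 0 N ^ k ∈ endFilt W 0 := by
      simpa using pow_mem_endFilt (comp_mem_endFilt hS 0 N) k
    have key : N ^ (k + 1) - comp hS.1 0 N ^ (k + 1) =
        (N ^ k - comp hS.1 0 N ^ k) * N + comp hS.1 0 N ^ k * (N - comp hS.1 0 N) := by
      rw [pow_succ, pow_succ]
      noncomm_ring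
    rw [key]
    exact add_mem (mul_mem_endFilt_of_eq ih hN (by ring))
      (mul_mem_endFilt_of_eq h0 (sub_comp_mem_endFilt hS hN) (by ring))

end Filtration

lemma isWeightDecomp_comp {V : Type*} [AddCommGroup V] [Module ℚ V] [FiniteDimensional ℚ V]
    {U : ℤ → Submodule ℚ V} (hU : DirectSum.IsInternal U) (f : Module.End ℚ V) :
    IsWeightDecomp U f fun w => comp hU w f := by
  obtain ⟨b, hb⟩ := exists_bound hU
  have hbot : ∀ m, ∀ x ∈ U m, x ≠ 0 → -(b : ℤ) ≤ m ∧ m ≤ b := by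
    intro m x hx h0
    by_contra hm
    rw [hb m (by omega)] at hx
    exact h0 (by simpa using hx)
  have hsupp : (Function.support fun w => comp hU w f) ⊆ Finset.Icc (-2 * b : ℤ) (2 * b) := by
    intro w hw
    by_contra hw'
    refine hw (grading_ext hU fun m x hx => ?_)
    by_contra h0
    have h1 := hbot _ _ (comp_mem hU w f hx) h0
    have h2 := hbot m x hx (by rintro rfl; simp at h0)
    simp only [Finset.coe_Icc, Set.mem_Icc] at hw'
    omega
  refine ⟨(Finset.finite_toSet _).subset hsupp, ?_, fun w m x hx => comp_mem hU w f hx⟩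
  rw [finsum_eq_sum_of_support_subset _ hsupp]
  refine grading_ext hU fun m x hx => ?_
  by_cases h0 : x = 0
  · simp [h0]
  have hm := hbot m x hx h0
  have h1 := sum_proj hU ((Finset.Icc (-2 * b : ℤ) (2 * b)).map (addLeftEmbedding m)) fun i hi =>
    hb i (by
      by_contra hi'
      refine hi (Finset.mem_map.mpr ⟨i - m, ?_, by simp⟩)
      rw [Finset.mem_Icc]
      omega)
  have h2 := congr($h1 (f x))
  rw [Finset.sum_map, LinearMap.sum_apply] at h2
  rw [LinearMap.sum_apply]
  simpa [comp_apply hU _ f hx] using h2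

section Bigraded

variable {V : Type*} [AddCommGroup V] [Module ℚ V] {W W' U U' : ℤ → Submodule ℚ V}
  {N : Module.End ℚ V}

/-- `f` has bidegree `(w, v)` with respect to the bigrading `U m ⊓ U' n`. -/
def HasBidegree (U U' : ℤ → Submodule ℚ V) (f : Module.End ℚ V) (w v : ℤ) : Prop :=
  ∀ m n, ∀ x ∈ U m ⊓ U' n, f x ∈ U (m + w) ⊓ U' (n + v)

lemma HasBidegree.sub {f g : Module.End ℚ V} {w v : ℤ} (hf : HasBidegree U U' f w v)
    (hg : HasBidegree U U' g w v) : HasBidegree U U' (f - g) w v := fun m n x hx =>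
  sub_mem (hf m n x hx) (hg m n x hx)

lemma HasBidegree.mul {f g : Module.End ℚ V} {w v w' v' : ℤ} (hf : HasBidegree U U' f w v)
    (hg : HasBidegree U U' g w' v') : HasBidegree U U' (f * g) (w + w') (v + v') :=
  fun m n x hx => by
    rw [add_comm w, add_comm v, ← add_assoc, ← add_assoc]
    exact hf _ _ _ (hg m n x hx)

lemma HasBidegree.adE_pow {f g : Module.End ℚ V} {w v w' v' : ℤ} (hf : HasBidegree U U' f w v)
    (hg : HasBidegree U U' g w' v') (k : ℕ) :
    HasBidegree U U' (((adE f) ^ k) g) (w' + k * w) (v' + k * v) := by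
  induction k with
  | zero => simpa using hg
  | succ k ih =>
    rw [pow_succ', Module.End.mul_apply, adE_apply]
    have h1 := hf.mul ih
    have h2 := ih.mul hf
    rw [add_comm w, add_comm v] at h1
    have h3 := h1.sub h2
    convert h3 using 1 <;> push_cast <;> ring

lemma proj_comm
    (hI : DirectSum.IsInternal fun p : ℤ × ℤ => U p.1 ⊓ U' p.2)
    (hU : DirectSum.IsInternal U) (hU' : DirectSum.IsInternal U') (m n : ℤ) :
    proj hU m * proj hU' n = proj hU' n * proj hU m := by
  refine grading_ext hI fun p x hx => ?_
  simp only [Module.End.mul_apply]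
  by_cases h1 : p.1 = m <;> by_cases h2 : p.2 = n
  · rw [proj_same hU' (h2 ▸ hx.2), proj_same hU (h1 ▸ hx.1), proj_same hU' (h2 ▸ hx.2)]
  · rw [proj_ne hU' hx.2 h2, map_zero, proj_same hU (h1 ▸ hx.1), proj_ne hU' hx.2 h2]
  · rw [proj_same hU' (h2 ▸ hx.2), proj_ne hU hx.1 h1, map_zero]
  · rw [proj_ne hU' hx.2 h2, proj_ne hU hx.1 h1, map_zero, map_zero]

lemma proj_mem_right
    (hI : DirectSum.IsInternal fun p : ℤ × ℤ => U p.1 ⊓ U' p.2)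
    (hU : DirectSum.IsInternal U) (hU' : DirectSum.IsInternal U') (m : ℤ)
    {n : ℤ} {x : V} (hx : x ∈ U' n) : proj hU m x ∈ U' n := by
  rw [mem_iff_proj hU', ← Module.End.mul_apply, ← proj_comm hI hU hU', Module.End.mul_apply,
    proj_same hU' hx]

lemma proj_mem_of_splitting
    (hI : DirectSum.IsInternal fun p : ℤ × ℤ => U p.1 ⊓ U' p.2)
    (hS : IsSplitting W U) (hU' : DirectSum.IsInternal U') (n : ℤ)
    {w : ℤ} {x : V} (hx : x ∈ W w) : proj hU' n x ∈ W w := by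
  refine (filtration_le hS (S := (W w).comap (proj hU' n)) fun m hm y hy => ?_) hx
  refine splitting_le hS hm ?_
  rw [mem_iff_proj hS.1, ← Module.End.mul_apply, proj_comm hI hS.1 hU', Module.End.mul_apply,
    proj_same hS.1 hy]

lemma hasBidegree_comp
    (hI : DirectSum.IsInternal fun p : ℤ × ℤ => U p.1 ⊓ U' p.2)
    (hU : DirectSum.IsInternal U) (hU' : DirectSum.IsInternal U')
    {f : Module.End ℚ V} {v : ℤ} (hf : ∀ n, ∀ x ∈ U' n, f x ∈ U' (n + v)) (w : ℤ) :
    HasBidegree U U' (comp hU w f) w v := fun _ n x hx =>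
  ⟨comp_mem hU w f hx.1, comp_apply hU w f hx.1 ▸
    proj_mem_right hI hU hU' _ (hf n x hx.2)⟩

lemma eq_zero_of_mem_sup
    (hI : DirectSum.IsInternal fun p : ℤ × ℤ => U p.1 ⊓ U' p.2)
    (hS : IsSplitting W U) (hS' : IsSplitting W' U') {m n : ℤ} {y : V}
    (hy : y ∈ U m ⊓ U' n) (h : y ∈ W' (n - 1) ⊔ W (m - 1)) : y = 0 := by
  obtain ⟨a, ha, b, hb, rfl⟩ := Submodule.mem_sup.mp h
  have h1 : proj hS.1 m (proj hS'.1 n (a + b)) = a + b := by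
    rw [proj_same hS'.1 hy.2, proj_same hS.1 hy.1]
  rw [← h1, map_add, proj_eq_zero_of_lt hS' (by omega) ha, zero_add, ← Module.End.mul_apply,
    proj_comm hI hS.1 hS'.1, Module.End.mul_apply, proj_eq_zero_of_lt hS (by omega) hb, map_zero]

lemma eq_zero_of_mem_grSub
    (hI : DirectSum.IsInternal fun p : ℤ × ℤ => U p.1 ⊓ U' p.2)
    (hS : IsSplitting W U) (hS' : IsSplitting W' U') {w v : ℤ}
    {f : Module.End ℚ V} (hf : HasBidegree U U' f w v)
    (h : f ∈ grSub (endFilt W) (endFilt W') w (v - 1)) : f = 0 := by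
  obtain ⟨a, ha, b, hb, rfl⟩ := Submodule.mem_sup.mp h
  refine grading_ext hI fun p x hx => ?_
  refine eq_zero_of_mem_sup hI hS hS' (hf p.1 p.2 x hx) (add_mem ?_ ?_)
  · refine Submodule.mem_sup_left ?_
    rw [add_sub_assoc]
    exact ha.1 _ _ (splitting_le hS' le_rfl hx.2)
  · refine Submodule.mem_sup_right ?_
    rw [add_sub_assoc]
    exact hb _ _ (splitting_le hS le_rfl hx.1)

end Bigraded

/-- The components of `N` of weight `-(k + 1)` are primitive with respect to the weight zero
component of `N`; in particular the component of weight `-1` vanishes. -/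
def HasPrimitiveComponents {V : Type*} [AddCommGroup V] [Module ℚ V] {U : ℤ → Submodule ℚ V}
    (hU : DirectSum.IsInternal U) (N : Module.End ℚ V) : Prop :=
  ∀ k : ℕ, ((adE (comp hU 0 N)) ^ k) (comp hU (-(k + 1)) N) = 0

section Transport

variable {V : Type*} [AddCommGroup V] [Module ℚ V] {U U' : ℤ → Submodule ℚ V}

/-- Primitivity of the components is transported along injective intertwiners. -/
lemma HasPrimitiveComponents.of_intertwine {U₁ U₂ : ℤ → Submodule ℚ V}
    {hU₂ : DirectSum.IsInternal U₂} (hU₁ : DirectSum.IsInternal U₁) {N M e : Module.End ℚ V}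
    (hP : HasPrimitiveComponents hU₂ N) (he : Function.Injective e)
    (hU : ∀ m, ∀ x ∈ U₁ m, e x ∈ U₂ m) (hNM : e * M = N * e) :
    HasPrimitiveComponents hU₁ M := by
  have hproj : ∀ i, e * proj hU₁ i = proj hU₂ i * e := fun i => by
    refine grading_ext hU₁ fun m x hx => ?_
    simp only [Module.End.mul_apply]
    by_cases h : m = i
    · subst h
      rw [proj_same hU₁ hx, proj_same hU₂ (hU _ _ hx)]
    · rw [proj_ne hU₁ hx h, proj_ne hU₂ (hU _ _ hx) h, map_zero]
  have hcomp : ∀ w, e * comp hU₁ w M = comp hU₂ w N * e := fun w => by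
    refine grading_ext hU₁ fun m x hx => ?_
    simp only [Module.End.mul_apply]
    rw [comp_apply hU₁ w M hx, comp_apply hU₂ w N (hU _ _ hx), ← Module.End.mul_apply e, hproj,
      Module.End.mul_apply, ← Module.End.mul_apply e, hNM, Module.End.mul_apply]
  intro k
  have key : ∀ n : ℕ, ∀ w, e * ((adE (comp hU₁ 0 M)) ^ n) (comp hU₁ w M) =
      ((adE (comp hU₂ 0 N)) ^ n) (comp hU₂ w N) * e := by
    intro n w
    induction n with
    | zero => simpa using hcomp w
    | succ n ih =>
      simp only [pow_succ', Module.End.mul_apply, adE_apply]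
      rw [mul_sub, sub_mul, ← mul_assoc, hcomp, mul_assoc, ih, ← mul_assoc e, ih, mul_assoc _ e,
        hcomp]
      simp only [mul_assoc]
  have h0 := key k (-(k + 1))
  rw [hP k, zero_mul] at h0
  exact LinearMap.ext fun x => he (by simpa using congr($h0 x))

/-- The total grading by the difference of the degrees. -/
def diffGrading (U U' : ℤ → Submodule ℚ V) (j : ℤ) : Submodule ℚ V :=
  ⨆ m, U m ⊓ U' (m + j)

lemma HasBidegree.mem_diffGrading {f : Module.End ℚ V} {w v : ℤ}
    (hf : HasBidegree U U' f w v) (j : ℤ) (x : V) (hx : x ∈ diffGrading U U' j) :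
    f x ∈ diffGrading U U' (j + (v - w)) := by
  have : diffGrading U U' j ≤ (diffGrading U U' (j + (v - w))).comap f := by
    refine iSup_le fun i y hy => ?_
    refine (le_iSup (fun m => U m ⊓ U' (m + (j + (v - w)))) (i + w)) ?_
    convert hf _ _ y hy using 3
    ring
  exact this hx

lemma isInternal_diffGrading (hI : DirectSum.IsInternal fun p : ℤ × ℤ => U p.1 ⊓ U' p.2) :
    DirectSum.IsInternal (diffGrading U U') := by
  let H : Module.End ℚ V := glue hI fun p => ((p.2 - p.1 : ℤ) : ℚ) • 1
  refine DirectSum.isInternal_submodule_of_iSupIndep_of_iSup_eq_top ?_ ?_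
  · have h1 : iSupIndep fun j : ℤ => H.eigenspace (j : ℚ) :=
      H.eigenspaces_iSupIndep.comp Int.cast_injective
    refine h1.mono fun j => iSup_le fun m x hx => ?_
    rw [Module.End.mem_eigenspace_iff]
    have := glue_apply hI (fun p => ((p.2 - p.1 : ℤ) : ℚ) • 1) (i := (m, m + j)) hx
    simpa [H] using this
  · rw [eq_top_iff, ← hI.submodule_iSup_eq_top]
    refine iSup_le fun p => le_iSup_of_le (p.2 - p.1) (le_iSup_of_le p.1 ?_)
    rw [add_sub_cancel]

end Transport

section Deligne

variable {V : Type*} [AddCommGroup V] [Module ℚ V] [FiniteDimensional ℚ V]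
  {W W' U U' : ℤ → Submodule ℚ V} {N : Module.End ℚ V}

lemma hasPrimitiveComponents_of_isDeligneSplitting (hD : IsDeligneSplitting N W W' U' U)
    (hS' : IsSplitting W' U') (hNW : N ∈ endFilt W 0)
    (hNU' : ∀ n, ∀ x ∈ U' n, N x ∈ U' (n + -2)) : HasPrimitiveComponents hD.1.1 N := by
  obtain ⟨hS, hI, hc⟩ := hD
  obtain ⟨h1, h2⟩ := hc _ (isWeightDecomp_comp hS.1 N)
  have hbi := hasBidegree_comp hI hS.1 hS'.1 hNU'
  intro k
  refine eq_zero_of_mem_grSub hI hS hS' ((hbi 0).adE_pow (hbi _) k) ?_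
  rcases k.eq_zero_or_pos with rfl | hk
  · simpa using h1
  · obtain ⟨-, h3⟩ := h2 (-(k + 1)) (by omega)
    rw [show (-(-((k : ℤ) + 1)) - 1).toNat = k by omega] at h3
    have h4 := (adE_pow_sub_mem hS hNW (comp_mem_endFilt hS (-(k + 1)) N) k).1
    have h5 := sub_mem h3 (Submodule.mem_sup_right h4)
    rw [sub_sub_cancel] at h5
    convert h5 using 2 <;> ring

/-- The defining property of the relative monodromy filtration, on the level of a bigrading. -/
lemma lefschetz_of_isRelMonFil (hI : DirectSum.IsInternal fun p : ℤ × ℤ => U p.1 ⊓ U' p.2)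
    (hS : IsSplitting W U) (hS' : IsSplitting W' U') (hNW : N ∈ endFilt W 0)
    (hNU' : ∀ n, ∀ x ∈ U' n, N x ∈ U' (n + -2)) (h : IsRelMonFil N W W') (n : ℕ) :
    (∀ x ∈ diffGrading U U' n, (comp hS.1 0 N ^ n) x = 0 → x = 0) ∧
    (∀ y ∈ diffGrading U U' (-n), ∃ x ∈ diffGrading U U' n, (comp hS.1 0 N ^ n) x = y) := by
  have hsub := pow_sub_comp_pow_mem hS hNW n
  have hN₀ : ∀ m, ∀ x ∈ U m, (comp hS.1 0 N ^ n) x ∈ U (m + n * 0) :=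
    shift_pow (fun m x hx => comp_mem hS.1 0 N hx) n
  have hNn : ∀ m, ∀ x ∈ U' m, (N ^ n) x ∈ U' (m + n * -2) := shift_pow hNU' n
  constructor
  · intro x hx hNx
    refine eq_zero_of_proj hS.1 fun m => ?_
    have hm : proj hS.1 m x ∈ U m ⊓ U' (m + n) := by
      refine ⟨proj_mem _ _ _, ?_⟩
      refine (iSup_le (a := (U' (m + n)).comap (proj hS.1 m)) fun i y hy => ?_ :
        diffGrading U U' n ≤ _) hx
      rw [Submodule.mem_comap]
      by_cases him : i = m
      · subst him
        rw [proj_same hS.1 hy.1]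
        exact hy.2
      · simp [proj_ne hS.1 hy.1 him]
    have h0 : (comp hS.1 0 N ^ n) (proj hS.1 m x) = 0 := by
      have h1 := proj_shift hS.1 hN₀ (i := m) (j := m) (by ring)
      rw [← Module.End.mul_apply, ← h1, Module.End.mul_apply, hNx, map_zero]
    refine eq_zero_of_mem_sup hI hS hS' hm ?_
    have hxW := splitting_le hS le_rfl hm.1
    have h2 := hsub m _ hxW
    rw [LinearMap.sub_apply, h0, sub_zero] at h2
    have h3 := (h.2.2 m n).2.2.1 (proj hS.1 m x)
      (Submodule.mem_sup_left ⟨splitting_le hS' le_rfl hm.2, hxW⟩) (Submodule.mem_sup_right h2)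
    exact (sup_le_sup_right inf_le_left (W (m - 1))) h3
  · intro y hy
    refine (iSup_le (a := (diffGrading U U' n).map (comp hS.1 0 N ^ n)) fun m y hy => ?_ :
        diffGrading U U' (-n) ≤ _) hy
    have hyW : y ∈ grSub W W' m (m - n) :=
      Submodule.mem_sup_left ⟨splitting_le hS' le_rfl hy.2, splitting_le hS le_rfl hy.1⟩
    obtain ⟨u, hu, r, hr, hy'⟩ := Submodule.mem_sup.mp ((h.2.2 m n).2.2.2 hyW)
    obtain ⟨z, hz, rfl⟩ := hu
    obtain ⟨a, ha, b, hb, rfl⟩ := Submodule.mem_sup.mp hz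
    obtain ⟨c, hc, d, hd, rfl⟩ := Submodule.mem_sup.mp hr
    refine ⟨proj hS.1 m (proj hS'.1 (m + n) a), ?_, ?_⟩
    · exact (le_iSup (fun m => U m ⊓ U' (m + n)) m)
        ⟨proj_mem _ _ _, proj_mem_right hI hS.1 hS'.1 _ (proj_mem _ _ _)⟩
    have hNb : (N ^ n) b ∈ W (m - 1) := by
      have : N ^ n ∈ endFilt W 0 := by simpa using pow_mem_endFilt hNW n
      simpa using this _ b hb
    have hlow : ∀ z ∈ W (m - 1), proj hS.1 m (proj hS'.1 (m + -n) z) = 0 := fun z hz => by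
      rw [← Module.End.mul_apply, proj_comm hI hS.1 hS'.1, Module.End.mul_apply,
        proj_eq_zero_of_lt hS (by omega) hz, map_zero]
    have h1 : y = proj hS.1 m (proj hS'.1 (m + -n) ((N ^ n) a)) := by
      have h2 : proj hS.1 m (proj hS'.1 (m + -n) y) = y := by
        rw [proj_same hS'.1 hy.2, proj_same hS.1 hy.1]
      rw [← h2, ← hy', map_add, map_add, map_add, map_add, map_add, map_add, map_add, hlow _ hNb,
        hlow _ hd, proj_eq_zero_of_lt hS' (by omega) hc.1]
      simp
    have h3 := congr($(proj_shift hS'.1 hNn (i := m + -n) (j := m + n) (by ring)) a)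
    simp only [Module.End.mul_apply] at h3
    have haW : proj hS'.1 (m + n) a ∈ W m :=
      proj_mem_of_splitting hI hS hS'.1 _ ha.2
    have h4 := proj_eq_zero_of_lt hS (i := m) (by omega) (hsub m _ haW)
    rw [LinearMap.sub_apply, map_sub, sub_eq_zero] at h4
    rw [h1, h3, h4]
    exact congr($(proj_shift hS.1 hN₀ (i := m) (j := m) (by ring)) _).symm

end Deligne

section Uniqueness

variable {V : Type*} [AddCommGroup V] [Module ℚ V]

lemma exists_inverse_mem_endFilt {W : ℤ → Submodule ℚ V} (hW : IsFiniteFiltration W)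
    {a : Module.End ℚ V} (ha : a - 1 ∈ endFilt W (-1)) :
    ∃ b ∈ endFilt W 0, a * b = 1 ∧ b * a = 1 := by
  obtain ⟨d, hd⟩ := endFilt_eq_zero hW
  have hn : 1 - a ∈ endFilt W (-1) := by
    rw [← neg_sub]
    exact neg_mem ha
  have hpow : (1 - a) ^ d = 0 := hd _ (by simpa using pow_mem_endFilt hn d)
  refine ⟨∑ i ∈ Finset.range d, (1 - a) ^ i, sum_mem fun i _ => ?_, ?_, ?_⟩
  · exact endFilt_mono hW.1 (by simp) (pow_mem_endFilt hn i)
  · simpa [hpow] using mul_neg_geom_sum (1 - a) d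
  · simpa [hpow] using geom_sum_mul_neg (1 - a) d

variable {W W' U U' : ℤ → Submodule ℚ V} {N : Module.End ℚ V}

/-- The leading component of the equation `N * a = a * M`. -/
lemma adE_comp_of_intertwine (hW : IsFiniteFiltration W) (hS : IsSplitting W U)
    (hNW : N ∈ endFilt W 0) {a M : Module.End ℚ V} (ha : a - 1 ∈ endFilt W (-1))
    (haM : N * a = a * M) {c : ℤ} (hc : c < 0) (hac : a - 1 ∈ endFilt W c) :
    comp hS.1 0 M = comp hS.1 0 N ∧
      adE (comp hS.1 0 N) (comp hS.1 c (a - 1)) = comp hS.1 c M - comp hS.1 c N := by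
  obtain ⟨b, hb, -, hba⟩ := exists_inverse_mem_endFilt hW ha
  have hcomm : N * (a - 1) - (a - 1) * N = a * (M - N) := by
    rw [mul_sub a, ← haM]
    noncomm_ring
  have hMN : M - N ∈ endFilt W c := by
    rw [← one_mul (M - N), ← hba, mul_assoc, ← hcomm]
    exact mul_mem_endFilt_of_eq hb (sub_mem (mul_mem_endFilt_of_eq hNW hac (zero_add c))
      (mul_mem_endFilt_of_eq hac hNW (add_zero c))) (zero_add c)
  have ha0 : a ∈ endFilt W 0 := by
    rw [← sub_add_cancel a 1]
    exact add_mem (endFilt_mono hW.1 (by omega) ha) fun w x hx => by simpa using hx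
  have hca : comp hS.1 0 a = 1 := by
    have h1 := comp_eq_zero hS (w := 0) (by omega) ha
    rwa [comp_sub, comp_zero_one, sub_eq_zero] at h1
  constructor
  · have h1 := comp_eq_zero hS hc hMN
    rwa [comp_sub, sub_eq_zero] at h1
  · have h1 := congr(comp hS.1 c $hcomm)
    rw [comp_mul hS ha0 hMN (zero_add c), hca, one_mul, comp_sub hS.1 c M,
      comp_sub hS.1 c (N * (a - 1)), comp_mul hS hNW hac (zero_add c),
      comp_mul hS hac hNW (add_zero c)] at h1
    exact h1

variable [FiniteDimensional ℚ V]

/-- The defining property of the relative monodromy filtration, passed on to `End(V)`. -/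
lemma eq_zero_of_adE_comp_pow_eq_zero
    (hI : DirectSum.IsInternal fun p : ℤ × ℤ => U p.1 ⊓ U' p.2)
    (hS : IsSplitting W U) (hS' : IsSplitting W' U') (hNW : N ∈ endFilt W 0)
    (hNU' : ∀ n, ∀ x ∈ U' n, N x ∈ U' (n + -2)) (h : IsRelMonFil N W W') {k : ℕ}
    {t : Module.End ℚ V} (ht : HasBidegree U U' t (-k) 0)
    (h0 : ((adE (comp hS.1 0 N)) ^ k) t = 0) : t = 0 := by
  have hN₀ : HasBidegree U U' (comp hS.1 0 N) 0 (-2) := hasBidegree_comp hI hS.1 hS'.1 hNU' 0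
  have hL := lefschetz_of_isRelMonFil hI hS hS' hNW hNU' h
  refine eq_zero_of_adE_pow_eq_zero (isInternal_diffGrading hI) ?_ (fun n => (hL n).1)
    (fun n => (hL n).2) (fun j x hx => ?_) h0
  · simpa only [sub_zero] using hN₀.mem_diffGrading
  · simpa only [zero_sub, neg_neg] using ht.mem_diffGrading j x hx

/-- A unipotent intertwiner between two endomorphisms with primitive components is trivial. -/
lemma eq_one_of_hasPrimitiveComponents (hW : IsFiniteFiltration W)
    (hI : DirectSum.IsInternal fun p : ℤ × ℤ => U p.1 ⊓ U' p.2)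
    (hS : IsSplitting W U) (hS' : IsSplitting W' U') (hNW : N ∈ endFilt W 0)
    (hNU' : ∀ n, ∀ x ∈ U' n, N x ∈ U' (n + -2)) (h : IsRelMonFil N W W')
    {a M : Module.End ℚ V} (ha : a - 1 ∈ endFilt W (-1))
    (haM : N * a = a * M) (haU' : ∀ n, ∀ x ∈ U' n, a x ∈ U' n)
    (hPN : HasPrimitiveComponents hS.1 N) (hPM : HasPrimitiveComponents hS.1 M) : a = 1 := by
  have key : ∀ k : ℕ, a - 1 ∈ endFilt W (-(k + 1)) := by
    intro k
    induction k with
    | zero => simpa using ha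
    | succ k ih =>
      obtain ⟨hM₀, had⟩ := adE_comp_of_intertwine hW hS hNW ha haM (by omega) ih
      have hbi : HasBidegree U U' (comp hS.1 (-(k + 1)) (a - 1)) (-(k + 1)) 0 :=
        hasBidegree_comp hI hS.1 hS'.1 (fun n x hx => by
          rw [add_zero]
          exact sub_mem (haU' n x hx) hx) _
      have ht : comp hS.1 (-(k + 1)) (a - 1) = 0 := by
        refine eq_zero_of_adE_comp_pow_eq_zero hI hS hS' hNW hNU' h (k := k + 1)
          (by exact_mod_cast hbi) ?_
        have h1 := hPM k
        rw [hM₀] at h1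
        rw [pow_succ, Module.End.mul_apply, had, map_sub, h1, hPN k, sub_zero]
      have h2 := sub_comp_mem_endFilt hS ih
      rw [ht, sub_zero] at h2
      rwa [Nat.cast_succ, neg_add _ (1 : ℤ), ← sub_eq_add_neg]
  obtain ⟨d, hd⟩ := endFilt_eq_zero hW
  exact sub_eq_zero.mp (hd _ (endFilt_mono hW.1 (by omega) (key d)))

/-- Uniqueness of the Deligne splitting. -/
lemma splitting_eq_of_hasPrimitiveComponents {U₁ U₂ : ℤ → Submodule ℚ V}
    (hW : IsFiniteFiltration W)
    (hI₁ : DirectSum.IsInternal fun p : ℤ × ℤ => U₁ p.1 ⊓ U' p.2)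
    (hI₂ : DirectSum.IsInternal fun p : ℤ × ℤ => U₂ p.1 ⊓ U' p.2)
    (hS₁ : IsSplitting W U₁) (hS₂ : IsSplitting W U₂) (hS' : IsSplitting W' U')
    (hNW : N ∈ endFilt W 0) (hNU' : ∀ n, ∀ x ∈ U' n, N x ∈ U' (n + -2))
    (h : IsRelMonFil N W W') (hP₁ : HasPrimitiveComponents hS₁.1 N)
    (hP₂ : HasPrimitiveComponents hS₂.1 N) (w : ℤ) : U₁ w = U₂ w := by
  let a : Module.End ℚ V := glue hS₁.1 fun m => proj hS₂.1 m
  have haU : ∀ m, ∀ x ∈ U₁ m, a x = proj hS₂.1 m x := fun m x hx => glue_apply hS₁.1 _ hx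
  have ha : a - 1 ∈ endFilt W (-1) := by
    refine mem_endFilt_of_splitting hS₁ fun m x hx => ?_
    rw [LinearMap.sub_apply, haU m x hx, ← neg_sub]
    exact neg_mem (sub_proj_mem hS₂ (splitting_le hS₁ le_rfl hx))
  obtain ⟨b, -, hab, hba⟩ := exists_inverse_mem_endFilt hW ha
  have haM : N * a = a * (b * N * a) := by
    rw [← mul_assoc, ← mul_assoc, hab, one_mul]
  have hmap : ∀ m, ∀ x ∈ U₁ m, a x ∈ U₂ m := fun m x hx => haU m x hx ▸ proj_mem _ _ _
  have haU' : ∀ n, ∀ x ∈ U' n, a x ∈ U' n := by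
    intro n x hx
    have hcomm : proj hS'.1 n * a = a * proj hS'.1 n := by
      refine grading_ext hS₁.1 fun m y hy => ?_
      have hy' : proj hS'.1 n y ∈ U₁ m := by
        rw [mem_iff_proj hS₁.1, ← Module.End.mul_apply, proj_comm hI₁ hS₁.1 hS'.1,
          Module.End.mul_apply, proj_same hS₁.1 hy]
      rw [Module.End.mul_apply, Module.End.mul_apply, haU m y hy, haU m _ hy']
      exact congr($(proj_comm hI₂ hS₂.1 hS'.1 m n) y).symm
    rw [mem_iff_proj hS'.1, ← Module.End.mul_apply, hcomm, Module.End.mul_apply,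
      proj_same hS'.1 hx]
  have hPM : HasPrimitiveComponents hS₁.1 (b * N * a) := by
    refine hP₂.of_intertwine hS₁.1 (e := a) ?_ hmap haM.symm
    exact Function.LeftInverse.injective (g := b) fun x => congr($hba x)
  have h1 := eq_one_of_hasPrimitiveComponents hW hI₁ hS₁ hS' hNW hNU' h ha haM haU' hP₁ hPM
  refine grading_eq_of_le hS₁.1 hS₂.1 (fun m x hx => ?_) w
  simpa [h1] using hmap m x hx

end Uniqueness

section Automorphism

variable {V : Type*} [AddCommGroup V] [Module ℚ V] {W W' U'₁ U'₂ : ℤ → Submodule ℚ V}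
  {g : V ≃ₗ[ℚ] V}

/-- An automorphism carrying one splitting of `W'` to another and acting trivially on `gr W'`
commutes with every endomorphism of degree `-2` for both splittings. -/
lemma commute_of_map_splitting {N : Module.End ℚ V}
    (hU'₁ : IsSplitting W' U'₁) (hU'₂ : IsSplitting W' U'₂)
    (hNU'₁ : ∀ w, ∀ x ∈ U'₁ w, N x ∈ U'₁ (w - 2))
    (hNU'₂ : ∀ w, ∀ x ∈ U'₂ w, N x ∈ U'₂ (w - 2))
    (hggr : ∀ w, ∀ x ∈ W' w, g x - x ∈ W' (w - 1))
    (hgU : ∀ w, ∀ x ∈ U'₁ w, g x ∈ U'₂ w) : (g : V →ₗ[ℚ] V) * N = N * (g : V →ₗ[ℚ] V) := by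
  have hNW' : ∀ w, ∀ x ∈ W' w, N x ∈ W' (w - 2) := fun w x hx =>
    (filtration_le hU'₁ (S := (W' (w - 2)).comap N) fun n hn y hy =>
      splitting_le hU'₁ (by omega) (hNU'₁ n y hy)) hx
  refine grading_ext hU'₁.1 fun w x hx => ?_
  have hxW := splitting_le hU'₁ le_rfl hx
  change g (N x) = N (g x)
  have h1 : g (N x) - N (g x) ∈ U'₂ (w - 2) :=
    sub_mem (hgU _ _ (hNU'₁ w x hx)) (hNU'₂ w _ (hgU w x hx))
  have h2 : g (N x) - N (g x) ∈ W' (w - 2 - 1) := by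
    have h3 := hggr _ _ (hNW' w x hxW)
    have h4 := hNW' _ _ (hggr w x hxW)
    rw [map_sub, show w - 1 - 2 = w - 2 - 1 by ring] at h4
    have h5 := sub_mem h3 h4
    rwa [sub_sub_sub_cancel_right] at h5
  rw [← sub_eq_zero, ← proj_same hU'₂.1 h1]
  exact proj_eq_zero_of_lt hU'₂ (by omega) h2

lemma map_mem_of_compatible (hU'₁ : IsSplitting W' U'₁) (hU'₂ : IsSplitting W' U'₂)
    (hcompat₁ : ∀ w : ℤ, W w = ⨆ n : ℤ, W w ⊓ U'₁ n)
    (hcompat₂ : ∀ w : ℤ, W w = ⨆ n : ℤ, W w ⊓ U'₂ n)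
    (hggr : ∀ w, ∀ x ∈ W' w, g x - x ∈ W' (w - 1))
    (hgU : ∀ w, ∀ x ∈ U'₁ w, g x ∈ U'₂ w) {w : ℤ} {x : V} (hx : x ∈ W w) : g x ∈ W w := by
  have hproj : ∀ n, W w ≤ (W w).comap (proj hU'₂.1 n) := fun n => by
    conv_lhs => rw [hcompat₂ w]
    refine iSup_le fun m y hy => ?_
    rw [Submodule.mem_comap]
    by_cases h : m = n
    · subst h
      rw [proj_same hU'₂.1 hy.2]
      exact hy.1
    · simp [proj_ne hU'₂.1 hy.2 h]
  have hle : W w ≤ (W w).comap (g : V →ₗ[ℚ] V) := by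
    conv_lhs => rw [hcompat₁ w]
    refine iSup_le fun n y hy => ?_
    have h1 : proj hU'₂.1 n y = g y := by
      have h2 := proj_eq_zero_of_lt hU'₂ (i := n) (by omega)
        (hggr n y (splitting_le hU'₁ le_rfl hy.2))
      rw [map_sub, sub_eq_zero] at h2
      rw [← h2, proj_same hU'₂.1 (hgU n y hy.2)]
    change g y ∈ W w
    rw [← h1]
    exact hproj n hy.1
  exact hle hx

end Automorphism

end DeligneSplitting

open DeligneSplitting

/-- with `g` the unique automorphism carrying the splitting `U'₁` of `W'` to
the splitting `U'₂` (preserving `W'` and inducing the identity on each `gr^{W'}_w`), the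
Deligne splitting of `W` associated to `U'₂` is the image under `g` of the Deligne splitting
associated to `U'₁`. -/
theorem deligne_splitting_transforms_by_g
    {V : Type*} [AddCommGroup V] [Module ℚ V] [FiniteDimensional ℚ V]
    (W W' : ℤ → Submodule ℚ V) (hW : IsFiniteFiltration W)
    (N : Module.End ℚ V) (hNnil : IsNilpotent N)
    (hNW : ∀ w : ℤ, ∀ x ∈ W w, N x ∈ W w)
    (h : IsRelMonFil N W W')
    (U'₁ U'₂ : ℤ → Submodule ℚ V)
    (hU'₁ : IsSplitting W' U'₁)
    (hNU'₁ : ∀ w : ℤ, ∀ x ∈ U'₁ w, N x ∈ U'₁ (w - 2))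
    (hcompat₁ : ∀ w : ℤ, W w = ⨆ n : ℤ, W w ⊓ U'₁ n)
    (hU'₂ : IsSplitting W' U'₂)
    (hNU'₂ : ∀ w : ℤ, ∀ x ∈ U'₂ w, N x ∈ U'₂ (w - 2))
    (hcompat₂ : ∀ w : ℤ, W w = ⨆ n : ℤ, W w ⊓ U'₂ n)
    (g : V ≃ₗ[ℚ] V)
    (hgW' : ∀ w : ℤ, Submodule.map (g : V →ₗ[ℚ] V) (W' w) = W' w)
    (hggr : ∀ w : ℤ, ∀ x ∈ W' w, g x - x ∈ W' (w - 1))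
    (hgU : ∀ w : ℤ, Submodule.map (g : V →ₗ[ℚ] V) (U'₁ w) = U'₂ w)
    (U₁ U₂ : ℤ → Submodule ℚ V)
    (hD₁ : IsDeligneSplitting N W W' U'₁ U₁)
    (hD₂ : IsDeligneSplitting N W W' U'₂ U₂) :
    ∀ w : ℤ, U₂ w = Submodule.map (g : V →ₗ[ℚ] V) (U₁ w) := by
  have hgU' : ∀ w, ∀ x ∈ U'₁ w, g x ∈ U'₂ w := fun w x hx => by
    rw [← hgU w]
    exact Submodule.mem_map_of_mem hx
  have hcomm := commute_of_map_splitting hU'₁ hU'₂ hNU'₁ hNU'₂ hggr hgU'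
  have hgW : ∀ w, (W w).comap (g : V →ₗ[ℚ] V) = W w := fun w => by
    have h1 : (W w).map (g : V →ₗ[ℚ] V) = W w :=
      Submodule.eq_of_le_of_finrank_eq
        (Submodule.map_le_iff_le_comap.mpr fun x hx =>
          map_mem_of_compatible hU'₁ hU'₂ hcompat₁ hcompat₂ hggr hgU' hx)
        (LinearEquiv.finrank_map_eq g (W w))
    conv_lhs => rw [← h1]
    exact Submodule.comap_map_eq_of_injective g.injective _
  have hU'c : ∀ n, (U'₂ n).comap (g : V →ₗ[ℚ] V) = U'₁ n := fun n => by
    rw [← hgU n]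
    exact Submodule.comap_map_eq_of_injective g.injective _
  have hS : IsSplitting W fun m => (U₂ m).comap (g : V →ₗ[ℚ] V) := by
    refine ⟨isInternal_comap hD₂.1.1 g, fun w => ?_⟩
    rw [← hgW w, hD₂.1.2 w]
    simp only [← Submodule.orderIsoMapComap_symm_apply, OrderIso.map_iSup]
  have hI : DirectSum.IsInternal
      fun p : ℤ × ℤ => (U₂ p.1).comap (g : V →ₗ[ℚ] V) ⊓ U'₁ p.2 := by
    have h1 := isInternal_comap hD₂.2.1 g
    simp only [Submodule.comap_inf, hU'c] at h1
    exact h1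
  have hN0 : N ∈ endFilt W 0 := fun w x hx => by simpa using hNW w x hx
  have hP₁ := hasPrimitiveComponents_of_isDeligneSplitting hD₁ hU'₁ hN0 hNU'₁
  have hP₂ := hasPrimitiveComponents_of_isDeligneSplitting hD₂ hU'₂ hN0 hNU'₂
  have hP₃ : HasPrimitiveComponents hS.1 N :=
    hP₂.of_intertwine hS.1 (e := (g : V →ₗ[ℚ] V)) g.injective (fun m x hx => hx) hcomm
  intro w
  have h1 : U₁ w = (U₂ w).comap (g : V →ₗ[ℚ] V) :=
    splitting_eq_of_hasPrimitiveComponents (U₂ := fun m => (U₂ m).comap (g : V →ₗ[ℚ] V))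
      hW hD₁.2.1 hI hD₁.1 hS hU'₁ hN0 hNU'₁ h hP₁ hP₃ w
  rw [h1]
  exact (Submodule.map_comap_eq_of_surjective g.surjective (U₂ w)).symm
end
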